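/- arXiv:2205.13906 — 2 statements merged into one kernel-verified Lean document; each statement's English description precedes it below -/
import Mathlib

section
/- Let R be a Noetherian local ring with maximal ideal 𝔪 and residue field F = R/𝔪, let G ⊆ GL_n(R) be a finite subgroup, and set S = R[x_1,…,x_n] and S_F = F[x_1,…,x_n]. Let f_1,…,f_n be homogeneous elements of S^G. If the classes of f_1,…,f_n in S_F are invariant under the image of G in GL_n(F) and form a homogeneous system of parameters in S_F^G, then f_1,…,f_n form a homogeneous system of parameters in S^G. -/
open MvPolynomial TensorProduct

set_option synthInstance.maxHeartbeats 1000000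
set_option maxHeartbeats 1000000

/-- The action of `σ ∈ GLₙ(R)` on the polynomial ring `R[x₁,…,xₙ]`,
given by `σ(f) = f(σ⁻¹ (x₁,…,xₙ))`. -/
noncomputable def glAct {R : Type*} [CommRing R] {n : ℕ}
    (σ : Matrix.GeneralLinearGroup (Fin n) R) :
    MvPolynomial (Fin n) R →ₐ[R] MvPolynomial (Fin n) R :=
  MvPolynomial.aeval fun i =>
    ∑ j, ((σ⁻¹ : Matrix.GeneralLinearGroup (Fin n) R) : Matrix (Fin n) (Fin n) R) i j •
      MvPolynomial.X j

/-- The ring of invariants `R[x₁,…,xₙ]^G` of a subgroup `G ⊆ GLₙ(R)`,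
as a subalgebra of `R[x₁,…,xₙ]`. -/
noncomputable def invariants {R : Type*} [CommRing R] {n : ℕ}
    (G : Subgroup (Matrix.GeneralLinearGroup (Fin n) R)) :
    Subalgebra R (MvPolynomial (Fin n) R) :=
  ⨅ σ ∈ G, AlgHom.equalizer (glAct σ) (AlgHom.id R _)

/-- The map `GLₙ(R) → GLₙ(R')` induced by a ring homomorphism `R → R'`. -/
noncomputable def glMap {R R' : Type*} [CommRing R] [CommRing R'] {n : ℕ} (f : R →+* R') :
    Matrix.GeneralLinearGroup (Fin n) R →* Matrix.GeneralLinearGroup (Fin n) R' :=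
  Units.map (RingHom.toMonoidHom (RingHom.mapMatrix f))

/-- `R[x₁,…,xₙ]^G` is generated as an `R`-algebra by its homogeneous elements of
degree at most `d`. -/
def genByDeg {n : ℕ} (R : Type*) [CommRing R]
    (G : Subgroup (Matrix.GeneralLinearGroup (Fin n) R)) (d : ℕ) : Prop :=
  Algebra.adjoin R {f : MvPolynomial (Fin n) R |
    f ∈ invariants G ∧ ∃ i ≤ d, MvPolynomial.IsHomogeneous f i} = invariants G

/-- `f₁, …, fₘ` is a homogeneous system of parameters for `R[x₁,…,xₙ]^G`:
the `fᵢ` are invariant, homogeneous of positive degree, algebraically independent over `R`,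
and `R[x₁,…,xₙ]^G` is a finitely generated module over `R[f₁,…,fₘ]`. -/
def IsHSOPInv {n m : ℕ} {R : Type*} [CommRing R]
    (G : Subgroup (Matrix.GeneralLinearGroup (Fin n) R))
    (f : Fin m → MvPolynomial (Fin n) R) : Prop :=
  (∀ i, f i ∈ invariants G) ∧
  (∀ i, ∃ d : ℕ, 0 < d ∧ (f i).IsHomogeneous d) ∧
  AlgebraicIndependent R f ∧
  ∃ s : Finset (MvPolynomial (Fin n) R),
    ↑s ⊆ (invariants G : Set (MvPolynomial (Fin n) R)) ∧
    (invariants G : Set (MvPolynomial (Fin n) R)) ⊆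
      (Submodule.span (Algebra.adjoin R (Set.range f)) (s : Set (MvPolynomial (Fin n) R)) :
        Submodule (Algebra.adjoin R (Set.range f)) (MvPolynomial (Fin n) R))

/-- A commutative ring `T` is Cohen-Macaulay if for every maximal ideal `P` of `T`,
the localization `T_P` contains a regular sequence lying in its maximal ideal whose
length equals the Krull dimension of `T_P` (i.e. `depth T_P = dim T_P`). -/
def IsCohenMacaulayRing (T : Type*) [CommRing T] : Prop :=
  ∀ (P : Ideal T) (hP : P.IsMaximal),
    haveI : P.IsPrime := hP.isPrime
    ∃ rs : List (Localization.AtPrime P),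
      (∀ r ∈ rs, r ∈ IsLocalRing.maximalIdeal (Localization.AtPrime P)) ∧
      RingTheory.Sequence.IsRegular (Localization.AtPrime P) rs ∧
      (rs.length : WithBot ℕ∞) = ringKrullDim (Localization.AtPrime P)

section helpers

/-- degree-`d` part of the ideal generated by the homogeneous `f i`. -/
noncomputable def degPart {n : ℕ} {R : Type*} [CommRing R] (f : Fin n → MvPolynomial (Fin n) R)
    (dd : Fin n → ℕ) (d : ℕ) : Submodule R (MvPolynomial (Fin n) R) :=
  Submodule.span R {x | ∃ i g e, IsHomogeneous g e ∧ e + dd i = d ∧ x = g * f i}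

lemma degPart_le {n : ℕ} {R : Type*} [CommRing R] (f : Fin n → MvPolynomial (Fin n) R)
    (dd : Fin n → ℕ) (d : ℕ) :
    degPart f dd d ≤ (Ideal.span (Set.range f)).restrictScalars R := by
  refine Submodule.span_le.2 ?_
  rintro x ⟨i, g, e, -, -, rfl⟩
  exact Ideal.mul_mem_left _ _ (Ideal.subset_span ⟨i, rfl⟩)

lemma hc_mem_degPart {n : ℕ} {R : Type*} [CommRing R] (f : Fin n → MvPolynomial (Fin n) R)
    (dd : Fin n → ℕ) (hf : ∀ i, (f i).IsHomogeneous (dd i)) (d : ℕ)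
    {p : MvPolynomial (Fin n) R} (hp : p ∈ Ideal.span (Set.range f)) :
    homogeneousComponent d p ∈ degPart f dd d := by
  obtain ⟨c, rfl⟩ := Ideal.mem_span_range_iff_exists_fun.1 hp
  rw [map_sum]
  refine Submodule.sum_mem _ fun i _ => ?_
  rw [← sum_homogeneousComponent (c i), Finset.sum_mul, map_sum]
  refine Submodule.sum_mem _ fun k _ => ?_
  have h1 := (homogeneousComponent_isHomogeneous k (c i)).mul (hf i)
  rw [homogeneousComponent_of_mem ((mem_homogeneousSubmodule _ _).2 h1)]
  split_ifs with h
  · exact Submodule.subset_span ⟨i, _, k, homogeneousComponent_isHomogeneous k (c i), h.symm, rfl⟩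
  · exact Submodule.zero_mem _

/-- If `K[x]` is finite over `K[f]`, then high degree elements lie in the ideal of `f`. -/
lemma high_degree_mem {n : ℕ} {K : Type*} [CommRing K] (f : Fin n → MvPolynomial (Fin n) K)
    (dd : Fin n → ℕ) (hf : ∀ i, (f i).IsHomogeneous (dd i))
    (hfin : Module.Finite (Algebra.adjoin K (Set.range f)) (MvPolynomial (Fin n) K)) :
    ∃ N : ℕ, ∀ d, N < d → ∀ p : MvPolynomial (Fin n) K, p.IsHomogeneous d →
      p ∈ Ideal.span (Set.range f) := by
  obtain ⟨t, ht⟩ := hfin.fg_top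
  refine ⟨t.sup totalDegree, fun d hd p hp => ?_⟩
  have hadj : ∀ b ∈ Algebra.adjoin K (Set.range f),
      ∃ c : K, b - C c ∈ Ideal.span (Set.range f) := by
    intro b hb
    induction hb using Algebra.adjoin_induction with
    | mem x hx => exact ⟨0, by simpa using Ideal.subset_span hx⟩
    | algebraMap r => exact ⟨r, by simp [algebraMap_eq]⟩
    | add x y _ _ hx hy =>
      obtain ⟨a, ha⟩ := hx
      obtain ⟨b, hb⟩ := hy
      refine ⟨a + b, ?_⟩
      have := Ideal.add_mem _ ha hb
      rw [C_add]
      convert this using 1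
      ring
    | mul x y _ _ hx hy =>
      obtain ⟨a, ha⟩ := hx
      obtain ⟨b, hb⟩ := hy
      refine ⟨a * b, ?_⟩
      have := Ideal.add_mem _ (Ideal.mul_mem_right y _ ha) (Ideal.mul_mem_left _ (C a) hb)
      rw [C_mul]
      convert this using 1
      ring
  have key : ∀ p ∈ Submodule.span (Algebra.adjoin K (Set.range f))
      (t : Set (MvPolynomial (Fin n) K)),
      ∃ q ∈ Submodule.span K (t : Set (MvPolynomial (Fin n) K)),
        p - q ∈ Ideal.span (Set.range f) := by
    intro p hp
    induction hp using Submodule.span_induction with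
    | mem x hx => exact ⟨x, Submodule.subset_span hx, by simp⟩
    | zero => exact ⟨0, Submodule.zero_mem _, by simp⟩
    | add x y _ _ hx hy =>
      obtain ⟨a, ha, ha'⟩ := hx
      obtain ⟨b, hb, hb'⟩ := hy
      refine ⟨a + b, Submodule.add_mem _ ha hb, ?_⟩
      have := Ideal.add_mem _ ha' hb'
      convert this using 1
      ring
    | smul b x _ hx =>
      obtain ⟨q, hq, hq'⟩ := hx
      obtain ⟨c, hc⟩ := hadj b b.2
      refine ⟨c • q, Submodule.smul_mem _ _ hq, ?_⟩
      have := Ideal.add_mem _ (Ideal.mul_mem_left _ (b : MvPolynomial (Fin n) K) hq')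
        (Ideal.mul_mem_right q _ hc)
      rw [Algebra.smul_def, Algebra.smul_def, algebraMap_eq]
      convert this using 1
      change (b : MvPolynomial (Fin n) K) * x - C c * q = _
      ring
  obtain ⟨q, hq, hpq⟩ := key p (by rw [ht]; trivial)
  have hq0 : homogeneousComponent d q = 0 := by
    have : Submodule.span K (t : Set (MvPolynomial (Fin n) K)) ≤
        LinearMap.ker (homogeneousComponent d) := by
      refine Submodule.span_le.2 fun x hx => ?_
      exact homogeneousComponent_eq_zero _ _ (lt_of_le_of_lt (Finset.le_sup hx) hd)
    exact this hq
  have h2 := degPart_le _ _ _ (hc_mem_degPart f dd hf d hpq)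
  rw [map_sub, hq0, sub_zero,
    homogeneousComponent_of_mem ((mem_homogeneousSubmodule _ _).2 hp), if_pos rfl] at h2
  exact h2

/-- Nakayama: high degree elements lie in the ideal over `R` if they do over the residue field. -/
lemma lift_high_degree {n : ℕ} {R : Type*} [CommRing R] [IsLocalRing R]
    (f : Fin n → MvPolynomial (Fin n) R)
    (dd : Fin n → ℕ) (hf : ∀ i, (f i).IsHomogeneous (dd i)) (d : ℕ)
    (h : ∀ p : MvPolynomial (Fin n) (IsLocalRing.ResidueField R), p.IsHomogeneous d →
      p ∈ Ideal.span (Set.range fun i => MvPolynomial.map (IsLocalRing.residue R) (f i))) :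
    homogeneousSubmodule (Fin n) R d ≤ degPart f dd d := by
  refine Submodule.le_of_le_smul_of_le_jacobson_bot (I := IsLocalRing.maximalIdeal R)
    (homogeneousSubmodule_fg _ _ d) (IsLocalRing.maximalIdeal_le_jacobson _) ?_
  intro P hP
  have hP' : P.IsHomogeneous d := hP
  obtain ⟨c, hc⟩ := Ideal.mem_span_range_iff_exists_fun.1
    (h _ (hP'.map (IsLocalRing.residue R)))
  choose g hg using fun i =>
    MvPolynomial.map_surjective (σ := Fin n) _ (IsLocalRing.residue_surjective (R := R)) (c i)
  have hQ : (∑ i, g i * f i) ∈ Ideal.span (Set.range f) :=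
    Ideal.mem_span_range_iff_exists_fun.2 ⟨g, rfl⟩
  have h1 := hc_mem_degPart f dd hf d hQ
  have hcoeff : ∀ m, coeff m (P - ∑ i, g i * f i) ∈ IsLocalRing.maximalIdeal R := by
    intro m
    rw [← IsLocalRing.residue_eq_zero_iff, ← coeff_map]
    simp [hg, hc]
  have h2 : P - homogeneousComponent d (∑ i, g i * f i) ∈
      IsLocalRing.maximalIdeal R • homogeneousSubmodule (Fin n) R d := by
    have h3 : P - homogeneousComponent d (∑ i, g i * f i) =
        homogeneousComponent d (P - ∑ i, g i * f i) := by
      rw [map_sub, homogeneousComponent_of_mem hP, if_pos rfl]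
    rw [h3, homogeneousComponent_apply]
    refine Submodule.sum_mem _ fun m hm => ?_
    rw [← mul_one (coeff m _), ← smul_eq_mul, ← smul_monomial]
    refine Submodule.smul_mem_smul (hcoeff m) ?_
    exact isHomogeneous_monomial _ (Finset.mem_filter.1 hm).2
  have := Submodule.add_mem_sup h1 h2
  simpa using this

lemma finite_of_high_degree {n : ℕ} {R : Type*} [CommRing R]
    (f : Fin n → MvPolynomial (Fin n) R)
    (dd : Fin n → ℕ) (hdd : ∀ i, 0 < dd i) (N : ℕ)
    (h : ∀ d, N < d → homogeneousSubmodule (Fin n) R d ≤ degPart f dd d) :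
    Module.Finite (Algebra.adjoin R (Set.range f)) (MvPolynomial (Fin n) R) := by
  let U : Submodule R (MvPolynomial (Fin n) R) :=
    ⨆ d ∈ Finset.range (N + 1), homogeneousSubmodule (Fin n) R d
  have hU : U.FG := Submodule.fg_biSup _ _ fun d _ => homogeneousSubmodule_fg _ _ d
  obtain ⟨t, ht⟩ := hU
  let M := Submodule.span (Algebra.adjoin R (Set.range f)) (t : Set (MvPolynomial (Fin n) R))
  have hUM : U ≤ M.restrictScalars R := by
    rw [← ht]
    exact Submodule.span_le.2 Submodule.subset_span
  have hall : ∀ d, homogeneousSubmodule (Fin n) R d ≤ M.restrictScalars R := by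
    intro d
    induction d using Nat.strong_induction_on with
    | _ d ih =>
      by_cases hd : N < d
      · refine (h d hd).trans (Submodule.span_le.2 ?_)
        rintro x ⟨i, g, e, hg, he, rfl⟩
        have hgM : g ∈ M := ih e (by have := hdd i; omega) hg
        have := M.smul_mem ⟨f i, Algebra.subset_adjoin ⟨i, rfl⟩⟩ hgM
        rw [mul_comm]
        exact this
      · refine le_trans ?_ hUM
        exact le_biSup (fun d => homogeneousSubmodule (Fin n) R d)
          (Finset.mem_range.2 (by omega))
  refine ⟨⟨t, eq_top_iff.2 fun p _ => ?_⟩⟩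
  rw [← sum_homogeneousComponent p]
  exact Submodule.sum_mem _ fun k _ => hall k (homogeneousComponent_isHomogeneous k p)

lemma mem_invariants {R : Type*} [CommRing R] {n : ℕ}
    {G : Subgroup (Matrix.GeneralLinearGroup (Fin n) R)} {p : MvPolynomial (Fin n) R} :
    p ∈ invariants G ↔ ∀ σ ∈ G, glAct σ p = p := by
  simp [invariants, Algebra.mem_iInf, AlgHom.mem_equalizer]

lemma glAct_one {R : Type*} [CommRing R] {n : ℕ} (p : MvPolynomial (Fin n) R) :
    glAct (1 : Matrix.GeneralLinearGroup (Fin n) R) p = p := by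
  have : glAct (1 : Matrix.GeneralLinearGroup (Fin n) R) = AlgHom.id R _ := by
    ext1 i
    simp [glAct, Matrix.one_apply]
  rw [this]; rfl

lemma glAct_mul {R : Type*} [CommRing R] {n : ℕ}
    (σ τ : Matrix.GeneralLinearGroup (Fin n) R) (p : MvPolynomial (Fin n) R) :
    glAct (σ * τ) p = glAct σ (glAct τ p) := by
  have : glAct (σ * τ) = (glAct σ).comp (glAct τ) := by
    ext1 i
    simp only [glAct, aeval_X, AlgHom.comp_apply, map_sum, map_smul, mul_inv_rev, Units.val_mul,
      Matrix.mul_apply, Finset.sum_smul, Finset.smul_sum, smul_smul]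
    exact Finset.sum_comm
  rw [this]; rfl

/-- The polynomial ring is finite over `K[f]` if the invariants are. -/
lemma finite_poly {n : ℕ} {K : Type*} [CommRing K]
    (G : Subgroup (Matrix.GeneralLinearGroup (Fin n) K)) [Finite G]
    (f : Fin n → MvPolynomial (Fin n) K) (hinv : ∀ i, f i ∈ invariants G)
    (s : Finset (MvPolynomial (Fin n) K))
    (hs : (s : Set (MvPolynomial (Fin n) K)) ⊆ invariants G)
    (hspan : (invariants G : Set (MvPolynomial (Fin n) K)) ⊆
      (Submodule.span (Algebra.adjoin K (Set.range f)) (s : Set (MvPolynomial (Fin n) K)) :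
        Submodule (Algebra.adjoin K (Set.range f)) (MvPolynomial (Fin n) K))) :
    Module.Finite (Algebra.adjoin K (Set.range f)) (MvPolynomial (Fin n) K) := by
  have hle : Algebra.adjoin K (Set.range f) ≤ invariants G := by
    refine Algebra.adjoin_le ?_
    rintro _ ⟨i, rfl⟩
    exact hinv i
  let D : Subalgebra (Algebra.adjoin K (Set.range f)) (MvPolynomial (Fin n) K) :=
    { (invariants G).toSubsemiring with
      algebraMap_mem' := fun r => hle r.2 }
  have hD : ∀ p, p ∈ D ↔ p ∈ invariants G := fun p => Iff.rfl
  have hDs : Subalgebra.toSubmodule D =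
      Submodule.span (Algebra.adjoin K (Set.range f)) (s : Set (MvPolynomial (Fin n) K)) :=
    le_antisymm (fun x hx => hspan hx) (Submodule.span_le.2 fun x hx => hs hx)
  have hfin : Module.Finite (Algebra.adjoin K (Set.range f)) D :=
    (Module.Finite.iff_fg (N := Subalgebra.toSubmodule D)).2 ⟨s, hDs.symm⟩
  let _ : MulSemiringAction G (MvPolynomial (Fin n) K) :=
    { smul := fun σ p => glAct σ.1 p
      one_smul := fun p => glAct_one p
      mul_smul := fun σ τ p => glAct_mul σ.1 τ.1 p
      smul_zero := fun σ => map_zero _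
      smul_add := fun σ => map_add _
      smul_one := fun σ => map_one _
      smul_mul := fun σ => map_mul _ }
  have hI : Algebra.IsInvariant D (MvPolynomial (Fin n) K) G :=
    ⟨fun p hp => ⟨⟨p, mem_invariants.2 fun σ hσ => hp ⟨σ, hσ⟩⟩, rfl⟩⟩
  have i1 : Algebra.IsIntegral D (MvPolynomial (Fin n) K) :=
    Algebra.IsInvariant.isIntegral D (MvPolynomial (Fin n) K) G
  have i2 : Algebra.IsIntegral (Algebra.adjoin K (Set.range f)) (MvPolynomial (Fin n) K) :=
    Algebra.IsIntegral.trans D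
  have i3 : Algebra.FiniteType (Algebra.adjoin K (Set.range f)) (MvPolynomial (Fin n) K) :=
    Algebra.FiniteType.of_restrictScalars_finiteType K _ _
  exact Algebra.IsIntegral.finite

universe u

lemma algInd_lift {n : ℕ} {R : Type u} [CommRing R] [IsLocalRing R]
    (f : Fin n → MvPolynomial (Fin n) R)
    (h : AlgebraicIndependent (IsLocalRing.ResidueField R)
      (fun i => MvPolynomial.map (IsLocalRing.residue R) (f i))) :
    AlgebraicIndependent R f := by
  let k := IsLocalRing.ResidueField R
  let v : ULift.{u} (Fin n →₀ ℕ) → MvPolynomial (Fin n) R := fun a => aeval f (monomial a.down (1 : R))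
  let φ : k ⊗[R] MvPolynomial (Fin n) R →ₗ[k] MvPolynomial (Fin n) k :=
    LinearMap.liftBaseChange k (MvPolynomial.mapAlgHom (Algebra.ofId R k)).toLinearMap
  have hv : LinearIndependent R v := by
    apply Module.IsLocalRing.linearIndependent_of_flat
    apply LinearIndependent.of_comp φ
    have h1 : LinearIndependent k (fun a : ULift.{u} (Fin n →₀ ℕ) =>
        (aeval fun i => MvPolynomial.map (IsLocalRing.residue R) (f i)).toLinearMap
          (monomial a.down (1 : k))) := by
      have h2 := (basisMonomials (Fin n) k).linearIndependent.comp ULift.down.{u}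
        ULift.down_injective
      have h3 := h2.map' (aeval fun i => MvPolynomial.map (IsLocalRing.residue R) (f i)).toLinearMap
        (LinearMap.ker_eq_bot.2 h)
      have h4 : ∀ a : Fin n →₀ ℕ, basisMonomials (Fin n) k a = monomial a 1 := fun a => by simp
      simp only [Function.comp_def, h4] at h3
      exact h3
    convert h1 using 1
    ext1 a
    simp only [φ, v, Function.comp_apply, TensorProduct.mk_apply, LinearMap.liftBaseChange_tmul,
      one_smul, AlgHom.toLinearMap_apply, aeval_monomial, map_one, one_mul, mapAlgHom_apply]
    simp only [Finsupp.prod, map_prod, map_pow]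
    rfl
  rw [algebraicIndependent_iff]
  intro p hp
  rw [p.as_sum, map_sum] at hp
  have hv' := hv.comp ULift.up.{u} ULift.up_injective
  rw [linearIndependent_iff'] at hv'
  have := hv' p.support (fun a => coeff a p) (by
    rw [← hp]
    refine Finset.sum_congr rfl fun a _ => ?_
    simp only [v, Function.comp_apply]
    rw [← map_smul, smul_monomial, smul_eq_mul, mul_one])
  ext a
  by_cases ha : a ∈ p.support
  · simpa using this a ha
  · simpa using ha

end helpers

/-- Let `R` be a Noetherian local ring with residue field `F`, let
`G ⊆ GLₙ(R)` be a finite subgroup and let `f₁,…,fₙ` be homogeneous elements of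
`S^G = R[x₁,…,xₙ]^G`. If the classes of the `fᵢ` in `F[x₁,…,xₙ]` form a homogeneous
system of parameters in `F[x₁,…,xₙ]^G` (for the image of `G` in `GLₙ(F)`), then
`f₁,…,fₙ` form a homogeneous system of parameters in `S^G`. -/
theorem stmt_6 {n : ℕ} (R : Type*) [CommRing R] [IsNoetherianRing R] [IsLocalRing R]
    (G : Subgroup (Matrix.GeneralLinearGroup (Fin n) R)) [Finite G]
    (f : Fin n → MvPolynomial (Fin n) R)
    (hfinv : ∀ i, f i ∈ invariants G)
    (hfhom : ∀ i, ∃ d, (f i).IsHomogeneous d)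
    (hbar : IsHSOPInv (G.map (glMap (IsLocalRing.residue R)))
      (fun i => MvPolynomial.map (IsLocalRing.residue R) (f i))) :
    IsHSOPInv G f := by
  obtain ⟨hinv, hhom, halg, s, hs, hspan⟩ := hbar
  choose dd hdd using hfhom
  have hpos : ∀ i, 0 < dd i := by
    intro i
    obtain ⟨e, he, hfe⟩ := hhom i
    have := ((hdd i).map (IsLocalRing.residue R)).inj_right hfe (halg.ne_zero i)
    omega
  have : Finite (G.map (glMap (n := n) (IsLocalRing.residue R))) :=
    Finite.of_surjective _ ((glMap (n := n) (IsLocalRing.residue R)).subgroupMap_surjective G)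
  have hF := finite_poly _ _ hinv s hs hspan
  obtain ⟨N, hN⟩ := high_degree_mem _ dd (fun i => (hdd i).map (IsLocalRing.residue R)) hF
  have hfin := finite_of_high_degree f dd hpos N fun d hd =>
    lift_high_degree f dd hdd d (hN d hd)
  refine ⟨hfinv, fun i => ⟨dd i, hpos i, hdd i⟩, algInd_lift f halg, ?_⟩
  have hle : Algebra.adjoin R (Set.range f) ≤ invariants G := by
    refine Algebra.adjoin_le ?_
    rintro _ ⟨i, rfl⟩
    exact hfinv i
  have hnoeth : IsNoetherianRing (Algebra.adjoin R (Set.range f)) :=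
    have := Algebra.FiniteType.adjoin_of_finite (R := R) (Set.finite_range f)
    Algebra.FiniteType.isNoetherianRing R _
  let M : Submodule (Algebra.adjoin R (Set.range f)) (MvPolynomial (Fin n) R) :=
    { (invariants G).toSubsemiring.toAddSubmonoid with
      smul_mem' := fun c x hx => (invariants G).mul_mem (hle c.2) hx }
  obtain ⟨t, ht⟩ := IsNoetherian.noetherian M
  refine ⟨t, fun x hx => ?_, fun x hx => ?_⟩
  · have : x ∈ M := ht ▸ Submodule.subset_span hx
    exact this
  · have : x ∈ M := hx
    rw [← ht] at this
    exact this
end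

section
/- Let R be a Noetherian integral domain, G ⊆ GL_n(R) a finite subgroup, and S = R[x_1,…,x_n]. Assume that S^G is a Cohen-Macaulay ring and that f_1,…,f_n is a homogeneous system of parameters in S^G. Then S^G is generated as a module over the subalgebra R[f_1,…,f_n] by homogeneous elements of degree at most ∑_{i=1}^n (deg(f_i) − 1). -/
open MvPolynomial TensorProduct

set_option synthInstance.maxHeartbeats 1000000
set_option maxHeartbeats 1000000

namespace CMBound
open Module RingTheory.Sequence IsLocalRing

theorem withBot_le_of_add_one_le {a : WithBot ℕ∞} {D : ℕ} (h : a + 1 ≤ (D : WithBot ℕ∞) + 1) :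
    a ≤ D := by
  induction a with
  | bot => exact bot_le
  | coe a =>
    induction a using ENat.recTopCoe with
    | top =>
      exfalso
      have : ((⊤ : ℕ∞) : WithBot ℕ∞) + 1 = ((⊤ + 1 : ℕ∞) : WithBot ℕ∞) := rfl
      rw [this] at h
      have h2 : ((D : WithBot ℕ∞) + 1) = ((((D + 1 : ℕ)) : ℕ∞) : WithBot ℕ∞) := rfl
      rw [h2, WithBot.coe_le_coe] at h
      simp at h
    | coe a =>
      have : (a + 1 : ℕ) ≤ (D + 1 : ℕ) := by exact_mod_cast h
      have : a ≤ D := by omega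
      exact_mod_cast this

universe u v
variable {T : Type u} [CommRing T] [IsLocalRing T] [IsNoetherianRing T]

theorem exists_drop (D : ℕ) (N₁ N₂ : Type v) [AddCommGroup N₁] [AddCommGroup N₂] [Module T N₁]
    [Module T N₂] [Module.Finite T N₁] [Module.Finite T N₂]
    (h₁ : supportDim T N₁ ≤ (D : WithBot ℕ∞) + 1) (h₂ : supportDim T N₂ ≤ (D : WithBot ℕ∞) + 1) :
    ∃ z ∈ maximalIdeal T, supportDim T (QuotSMulTop z N₁) ≤ D ∧
      supportDim T (QuotSMulTop z N₂) ≤ D := by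
  classical
  have key : ∃ z ∈ maximalIdeal T, ∀ p ∈ (annihilator T N₁).minimalPrimes ∪
      (annihilator T N₂).minimalPrimes, p ≠ maximalIdeal T → z ∉ p := by
    have hfin : ((annihilator T N₁).minimalPrimes ∪ (annihilator T N₂).minimalPrimes).Finite :=
      ((annihilator T N₁).finite_minimalPrimes_of_isNoetherianRing T).union
        ((annihilator T N₂).finite_minimalPrimes_of_isNoetherianRing T)
    by_contra! hcon
    have := (Ideal.subset_union_prime (s := hfin.toFinset.filter (· ≠ maximalIdeal T))
      (f := id) ⊥ ⊥ (I := maximalIdeal T) (by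
        intro i hi _ _
        simp only [Finset.mem_filter, Set.Finite.mem_toFinset] at hi
        rcases hi.1 with h | h <;> exact h.isPrime)).1 (by
        intro z hz
        obtain ⟨p, hp, hpm, hzp⟩ := hcon z hz
        simp only [Set.mem_iUnion]
        exact ⟨p, by simpa [hpm] using hp, hzp⟩)
    obtain ⟨p, hp, hmp⟩ := this
    simp only [Finset.mem_filter, Set.Finite.mem_toFinset] at hp
    have hpp : p.IsPrime := by rcases hp.1 with h | h <;> exact h.isPrime
    exact hp.2 (le_antisymm (le_maximalIdeal hpp.ne_top) hmp)
  obtain ⟨z, hz, hz'⟩ := key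
  have aux : ∀ (N : Type v) [AddCommGroup N] [Module T N] [Module.Finite T N],
      supportDim T N ≤ (D : WithBot ℕ∞) + 1 → (∀ p ∈ (annihilator T N).minimalPrimes,
      p ≠ maximalIdeal T → z ∉ p) → supportDim T (QuotSMulTop z N) ≤ D := by
    intro N _ _ _ hN hp
    by_cases hm : maximalIdeal T ∈ (annihilator T N).minimalPrimes
    · have hsup : ∀ p ∈ Module.support T N, p.1 = maximalIdeal T := by
        intro p hp
        have h1 := (mem_support_iff_of_finite.mp hp)
        exact le_antisymm (le_maximalIdeal p.2.ne_top) (hm.2 ⟨p.2, h1⟩ (le_maximalIdeal p.2.ne_top))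
      have : Subsingleton (Module.support T (QuotSMulTop z N)) := by
        constructor
        intro a b
        have hsub : Module.support T (QuotSMulTop z N) ⊆ Module.support T N := by simp
        have ha := hsub a.2
        have hb := hsub b.2
        apply Subtype.ext
        apply PrimeSpectrum.ext
        rw [hsup _ ha, hsup _ hb]
      have h0 : supportDim T (QuotSMulTop z N) ≤ 0 := Order.krullDim_nonpos_of_subsingleton
      refine h0.trans ?_
      exact_mod_cast Nat.zero_le D
    · apply withBot_le_of_add_one_le
      refine le_trans (supportDim_quotSMulTop_succ_le_of_notMem_minimalPrimes ?_) hN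
      intro p hp'
      exact hp p hp' (fun h => hm (h ▸ hp'))
  exact ⟨z, hz, aux N₁ h₁ fun p hp => hz' p (Or.inl hp), aux N₂ h₂ fun p hp => hz' p (Or.inr hp)⟩

theorem supportDim_swap (M : Type v) [AddCommGroup M] [Module T M] [Module.Finite T M] (a z : T) :
    supportDim T (QuotSMulTop a (QuotSMulTop z M)) = supportDim T (QuotSMulTop z (QuotSMulTop a M)) := by
  have : Module.support T (QuotSMulTop a (QuotSMulTop z M)) =
      Module.support T (QuotSMulTop z (QuotSMulTop a M)) := by
    rw [Module.support_quotSMulTop, Module.support_quotSMulTop, Module.support_quotSMulTop,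
      Module.support_quotSMulTop, Set.inter_right_comm]
  unfold supportDim
  rw [this]

theorem cm_step (D : ℕ) : ∀ (M : Type v) [AddCommGroup M] [Module T M] [Module.Finite T M]
    (rs : List T), (∀ r ∈ rs, r ∈ maximalIdeal T) → IsRegular M rs → rs.length = D + 1 →
    ∀ a ∈ maximalIdeal T, supportDim T (QuotSMulTop a M) ≤ D →
    IsSMulRegular M a ∧ ∃ rs' : List T, (∀ r ∈ rs', r ∈ maximalIdeal T) ∧ rs'.length = D ∧
      IsRegular (QuotSMulTop a M) rs' := by
  induction D with
  | zero =>
    intro M _ _ _ rs hrs hreg hlen a ha hdim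
    have := hreg.nontrivial
    obtain ⟨x, rfl⟩ := List.length_eq_one_iff.1 (by simpa using hlen)
    have hx := hrs x (by simp)
    rw [isRegular_cons_iff] at hreg
    refine ⟨?_, [], by simp, rfl, ?_⟩
    · by_contra hna
      have h1 : a ∈ ⋃ p ∈ associatedPrimes T M, (p : Set T) := by
        rw [biUnion_associatedPrimes_eq_compl_regular]; exact hna
      simp only [Set.mem_iUnion] at h1
      obtain ⟨p, hp, hap⟩ := h1
      have hxp : x ∉ p := by
        intro hxp
        have : x ∈ ⋃ p ∈ associatedPrimes T M, (p : Set T) := by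
          simp only [Set.mem_iUnion]; exact ⟨p, hp, hxp⟩
        rw [biUnion_associatedPrimes_eq_compl_regular] at this
        exact this hreg.1
      have hpp : p.IsPrime := hp.isPrime
      have hps : (⟨p, hpp⟩ : PrimeSpectrum T) ∈ Module.support T (QuotSMulTop a M) := by
        rw [Module.support_quotSMulTop]
        refine ⟨?_, by simpa using hap⟩
        rw [mem_support_iff_of_finite]
        simpa [Submodule.annihilator_top] using IsAssociatedPrime.annihilator_le hp
      have hms : (IsLocalRing.closedPoint T) ∈ Module.support T (QuotSMulTop a M) :=
        Module.mem_support_mono (le_maximalIdeal hpp.ne_top) hps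
      have hlt : (⟨⟨p, hpp⟩, hps⟩ : Module.support T (QuotSMulTop a M)) <
          ⟨IsLocalRing.closedPoint T, hms⟩ := by
        refine lt_of_le_of_ne (show p ≤ maximalIdeal T from le_maximalIdeal hpp.ne_top) ?_
        intro h
        have : p = maximalIdeal T := congrArg (fun q => q.1.1) h
        exact hxp (this ▸ hx)
      have : (1 : WithBot ℕ∞) ≤ supportDim T (QuotSMulTop a M) := by
        have := Order.LTSeries.length_le_krullDim
          (RelSeries.singleton _ (⟨⟨p, hpp⟩, hps⟩ : Module.support T (QuotSMulTop a M)) |>.snoc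
            ⟨IsLocalRing.closedPoint T, hms⟩ hlt)
        exact this
      have h2 := this.trans hdim
      have h3 : (1 : ℕ) ≤ 0 := by exact_mod_cast h2
      omega
    · have := nontrivial_quotSMulTop_of_mem_maximalIdeal M ha
      exact IsRegular.nil _ _
  | succ D ih =>
    intro M _ _ _ rs hrs hreg hlen a ha hdim
    have := hreg.nontrivial
    match rs, hlen with
    | x :: rs0, hlen =>
    have hx := hrs x (by simp)
    have hreg' := (isRegular_cons_iff M x rs0).1 hreg
    have hdx : supportDim T (QuotSMulTop x M) ≤ (D : WithBot ℕ∞) + 1 := by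
      have h1 := supportDim_quotSMulTop_succ_eq_supportDim hreg'.1 hx
      have h2 := supportDim_le_supportDim_quotSMulTop_succ (M := M) ha
      have : supportDim T (QuotSMulTop x M) ≤ ((D + 1 : ℕ) : WithBot ℕ∞) := by
        apply withBot_le_of_add_one_le
        rw [h1]
        refine h2.trans ?_
        gcongr
      simpa using this
    obtain ⟨z, hz, hz1, hz2⟩ := exists_drop D (QuotSMulTop x M) (QuotSMulTop a M) hdx
      (by simpa using hdim)
    obtain ⟨hzreg, rs1, hrs1, hlen1, hreg1⟩ := ih (QuotSMulTop x M) rs0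
      (fun r hr => hrs r (by simp [hr])) hreg'.2 (by simpa using hlen) z hz hz1
    have hA : IsRegular M (x :: z :: rs1) := by
      rw [isRegular_cons_iff, isRegular_cons_iff]; exact ⟨hreg'.1, hzreg, hreg1⟩
    have hB : IsRegular M (z :: x :: rs1) := IsLocalRing.isRegular_of_perm hA (List.Perm.swap _ _ _)
    have hB' := (isRegular_cons_iff M z (x :: rs1)).1 hB
    obtain ⟨har, rs2, hrs2, hlen2, hreg2⟩ := ih (QuotSMulTop z M) (x :: rs1)
      (by simpa using ⟨hx, hrs1⟩) hB'.2 (by simp [hlen1]) a ha (by rw [supportDim_swap]; exact hz2)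
    have hC : IsRegular M (z :: a :: rs2) := by
      rw [isRegular_cons_iff, isRegular_cons_iff]; exact ⟨hB'.1, har, hreg2⟩
    have hE : IsRegular M (a :: z :: rs2) := IsLocalRing.isRegular_of_perm hC (List.Perm.swap _ _ _)
    have hE' := (isRegular_cons_iff M a (z :: rs2)).1 hE
    exact ⟨hE'.1, z :: rs2, by simpa using ⟨hz, hrs2⟩, by simp [hlen2], hE'.2⟩

theorem cm_list (l : List T) : ∀ (M : Type v) [AddCommGroup M] [Module T M] [Module.Finite T M]
    (rs : List T), (∀ r ∈ rs, r ∈ maximalIdeal T) → IsRegular M rs →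
    (∀ r ∈ l, r ∈ maximalIdeal T) → l.length ≤ rs.length →
    supportDim T (M ⧸ (Ideal.ofList l • (⊤ : Submodule T M))) ≤ (rs.length - l.length : ℕ) →
    IsWeaklyRegular M l := by
  induction l with
  | nil => intros; exact IsWeaklyRegular.nil _ _
  | cons a l ih =>
    intro M _ _ _ rs hrs hreg hl hle hdim
    have hdrop : ∀ (l : List T) (N : Type v) [AddCommGroup N] [Module T N] [Module.Finite T N],
        (∀ r ∈ l, r ∈ maximalIdeal T) → ∀ k : ℕ,
        supportDim T (N ⧸ (Ideal.ofList l • (⊤ : Submodule T N))) ≤ k →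
        supportDim T N ≤ (k + l.length : ℕ) := by
      intro l
      induction l with
      | nil =>
        intro N _ _ _ _ k hk
        have e : (N ⧸ (Ideal.ofList ([] : List T) • (⊤ : Submodule T N))) ≃ₗ[T] N :=
          Submodule.quotEquivOfEqBot _ (by simp)
        rw [supportDim_eq_of_equiv e] at hk
        simpa using hk
      | cons b l ih2 =>
        intro N _ _ _ hb k hk
        rw [supportDim_eq_of_equiv
          (Submodule.quotOfListConsSMulTopEquivQuotSMulTopInner N b l)] at hk
        have h1 := ih2 (QuotSMulTop b N) (fun r hr => hb r (by simp [hr])) k hk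
        have h2 := supportDim_le_supportDim_quotSMulTop_succ (M := N) (hb b (by simp))
        refine h2.trans ?_
        rw [List.length_cons, ← add_assoc, Nat.cast_succ]
        gcongr
    obtain ⟨D, hD⟩ : ∃ D, rs.length = D + 1 := ⟨rs.length - 1, by simp at hle; omega⟩
    rw [supportDim_eq_of_equiv
          (Submodule.quotOfListConsSMulTopEquivQuotSMulTopInner M a l)] at hdim
    have h1 := hdrop l (QuotSMulTop a M) (fun r hr => hl r (by simp [hr])) _ hdim
    obtain ⟨har, rs', hrs', hlen', hreg'⟩ := cm_step D M rs hrs hreg hD a (hl a (by simp)) (by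
      refine h1.trans ?_
      rw [List.length_cons] at *
      have : rs.length - (l.length + 1) + l.length = D := by omega
      rw [this])
    rw [isWeaklyRegular_cons_iff]
    refine ⟨har, ih _ rs' hrs' hreg' (fun r hr => hl r (by simp [hr])) (by simp at hle; omega) ?_⟩
    refine hdim.trans ?_
    rw [List.length_cons] at *
    have : rs.length - (l.length + 1) = rs'.length - l.length := by omega
    rw [this]

end CMBound

namespace CMBound
open Module RingTheory.Sequence IsLocalRing MvPolynomial

theorem exists_params_cons {R : Type*} [CommRing R] [IsDomain R] [IsNoetherianRing R]
    (m : Ideal R) [m.IsPrime] (a : R) (ha : a ∈ m) (ha0 : a ≠ 0) :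
    ∃ as : List R, (∀ r ∈ a :: as, r ∈ m) ∧ (((a :: as).length : ℕ) : ℕ∞) ≤ m.height ∧
      ∀ q : Ideal R, q.IsPrime → q ≤ m → (∀ r ∈ a :: as, r ∈ q) → q = m := by
  classical
  let I := Ideal.span {a}
  have hIm : I ≤ m := (Ideal.span_singleton_le_iff_mem m).2 ha
  have hp : (m.map (Ideal.Quotient.mk I)).IsPrime := Ideal.isPrime_map_quotientMk_of_isPrime hIm
  have hcm : (m.map (Ideal.Quotient.mk I)).comap (Ideal.Quotient.mk I) = m := by
    rw [Ideal.comap_map_of_surjective _ Ideal.Quotient.mk_surjective, ← RingHom.ker_eq_comap_bot,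
      Ideal.mk_ker, sup_eq_left.2 hIm]
  obtain ⟨s, hs, hcard⟩ := Ideal.exists_finset_card_eq_height_of_isNoetherianRing
    (m.map (Ideal.Quotient.mk I))
  have hh : (m.map (Ideal.Quotient.mk I)).height + 1 ≤ m.height := by
    let g : WithBot (PrimeSpectrum (R ⧸ I)) → PrimeSpectrum R := fun x =>
      WithBot.recBotCoe ⟨⊥, Ideal.isPrime_bot⟩ (fun q => PrimeSpectrum.comap (Ideal.Quotient.mk I) q) x
    have hg : StrictMono g := by
      intro x y hxy
      induction y with
      | bot => simp at hxy
      | coe y =>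
        induction x with
        | bot =>
          refine lt_of_le_of_ne (show (⊥ : Ideal R) ≤ _ from bot_le) ?_
          intro h
          have h1 : (⊥ : Ideal R) = y.1.comap (Ideal.Quotient.mk I) := congrArg (fun q => q.1) h
          have h2 : a ∈ y.1.comap (Ideal.Quotient.mk I) := by
            rw [Ideal.mem_comap, Ideal.Quotient.eq_zero_iff_mem.2 (Ideal.mem_span_singleton_self a)]
            exact y.1.zero_mem
          rw [← h1] at h2
          exact ha0 (by simpa using h2)
        | coe x =>
          have hxy' : x < y := by simpa using hxy
          have hxy2 : x.1 < y.1 := hxy'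
          refine lt_of_le_of_ne (Ideal.comap_mono hxy2.le) ?_
          intro h
          have h1 : x.1.comap (Ideal.Quotient.mk I) = y.1.comap (Ideal.Quotient.mk I) :=
            congrArg (fun q => q.1) h
          exact hxy2.ne (Ideal.comap_injective_of_surjective _ Ideal.Quotient.mk_surjective h1)
    have := Order.height_le_height_apply_of_strictMono g hg
      ((⟨_, hp⟩ : PrimeSpectrum (R ⧸ I)) : WithBot (PrimeSpectrum (R ⧸ I)))
    rw [Order.height_coe_withBot] at this
    have h1 := PrimeSpectrum.height_eq_orderHeight (⟨_, hp⟩ : PrimeSpectrum (R ⧸ I))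
    have h2 := PrimeSpectrum.height_eq_orderHeight (⟨m, inferInstance⟩ : PrimeSpectrum R)
    dsimp only at h1 h2
    rw [h1, h2]
    have e : g ((⟨_, hp⟩ : PrimeSpectrum (R ⧸ I)) : WithBot (PrimeSpectrum (R ⧸ I))) =
        ⟨m, inferInstance⟩ := PrimeSpectrum.ext hcm
    rw [e] at this
    exact this
  have hsm : ∀ r ∈ s, r ∈ m.map (Ideal.Quotient.mk I) := fun r hr => hs.1.2 (Ideal.subset_span hr)
  refine ⟨s.toList.map Quotient.out, ?_, ?_, ?_⟩
  · intro r hr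
    rcases List.mem_cons.1 hr with rfl | hr
    · exact ha
    · obtain ⟨t, ht, rfl⟩ := List.mem_map.1 hr
      rw [← hcm, Ideal.mem_comap]
      have : Ideal.Quotient.mk I (Quotient.out t) = t := Quotient.out_eq t
      rw [this]
      exact hsm t (by simpa using ht)
  · rw [List.length_cons, List.length_map, Finset.length_toList, Nat.cast_succ, hcard]
    exact hh
  · intro q hq hqm hr
    have hIq : I ≤ q := (Ideal.span_singleton_le_iff_mem q).2 (hr a (by simp))
    have hqp : (q.map (Ideal.Quotient.mk I)).IsPrime := Ideal.isPrime_map_quotientMk_of_isPrime hIq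
    have hcq : (q.map (Ideal.Quotient.mk I)).comap (Ideal.Quotient.mk I) = q := by
      rw [Ideal.comap_map_of_surjective _ Ideal.Quotient.mk_surjective, ← RingHom.ker_eq_comap_bot,
        Ideal.mk_ker, sup_eq_left.2 hIq]
    refine le_antisymm hqm ?_
    rw [← hcm, ← hcq]
    refine Ideal.comap_mono (hs.2 ⟨hqp, ?_⟩ (Ideal.map_mono hqm))
    rw [Ideal.span_le]
    intro t ht
    have : Ideal.Quotient.mk I (Quotient.out t) = t := Quotient.out_eq t
    rw [SetLike.mem_coe, ← this]
    exact Ideal.mem_map_of_mem _ (hr _ (by simp only [List.mem_cons, List.mem_map]; exact Or.inr ⟨t, by simpa using ht, rfl⟩))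

theorem exists_params {R : Type*} [CommRing R] [IsDomain R] [IsNoetherianRing R]
    (m : Ideal R) [m.IsPrime] :
    ∃ as : List R, (∀ r ∈ as, r ∈ m) ∧ (((as).length : ℕ) : ℕ∞) ≤ m.height ∧
      ∀ q : Ideal R, q.IsPrime → q ≤ m → (∀ r ∈ as, r ∈ q) → q = m := by
  by_cases h : ∃ a ∈ m, a ≠ 0
  · obtain ⟨a, ha, ha0⟩ := h
    obtain ⟨as, h⟩ := exists_params_cons m a ha ha0
    exact ⟨_, h⟩
  · push Not at h
    refine ⟨[], by simp, by simp, fun q _ hqm _ => le_antisymm hqm fun x hx => ?_⟩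
    rw [h x hx]; exact q.zero_mem

theorem height_origin {R : Type*} [CommRing R] [IsNoetherianRing R] (m : Ideal R) [m.IsMaximal]
    (n : ℕ) : (m.comap (constantCoeff : MvPolynomial (Fin n) R →+* R)).height = m.height + n := by
  induction n with
  | zero =>
    have : m.comap (constantCoeff : MvPolynomial (Fin 0) R →+* R) =
        m.comap ((isEmptyAlgEquiv R (Fin 0)).toRingEquiv) := by
      ext x
      rw [Ideal.mem_comap, Ideal.mem_comap]
      have : constantCoeff x = (isEmptyAlgEquiv R (Fin 0)).toRingEquiv x := by
        obtain ⟨y, rfl⟩ := C_surjective (R := R) (Fin 0) x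
        have := (isEmptyAlgEquiv R (Fin 0)).commutes y
        rw [constantCoeff_C]
        exact this.symm
      rw [this]
    rw [this, RingEquiv.height_comap]; simp
  | succ n ih =>
    let p := m.comap (constantCoeff : MvPolynomial (Fin n) R →+* R)
    have hsur : Function.Surjective (constantCoeff : MvPolynomial (Fin n) R →+* R) :=
      fun r => ⟨C r, by simp⟩
    have hsur2 : Function.Surjective (Polynomial.constantCoeff : Polynomial (MvPolynomial (Fin n) R) →+* _) :=
      fun r => ⟨Polynomial.C r, by simp⟩
    have hpm : p.IsMaximal := Ideal.comap_isMaximal_of_surjective _ hsur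
    let P : Ideal (Polynomial (MvPolynomial (Fin n) R)) := p.comap Polynomial.constantCoeff
    have hPm : P.IsMaximal := Ideal.comap_isMaximal_of_surjective _ hsur2
    have hlo : P.LiesOver p := ⟨by
      ext x; simp [P, Ideal.under, Ideal.mem_comap]⟩
    have h1 := Polynomial.height_eq_height_add_one p P
    have h2 : m.comap (constantCoeff : MvPolynomial (Fin (n+1)) R →+* R) =
        P.comap ((finSuccEquiv R n).toRingEquiv) := by
      ext x
      simp only [P, p, Ideal.mem_comap]
      have : constantCoeff x = constantCoeff (Polynomial.constantCoeff ((finSuccEquiv R n).toRingEquiv x)) := by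
        induction x using MvPolynomial.induction_on with
        | C a => simp [finSuccEquiv_apply]
        | add p q hp hq => simp only [map_add, hp, hq]
        | mul_X p i hp =>
          rw [map_mul, map_mul, map_mul, map_mul, hp]
          congr 1
          refine Fin.cases ?_ ?_ i <;> simp [finSuccEquiv_apply]
      rw [this]
    rw [h2, RingEquiv.height_comap, h1, ih]
    push_cast
    ring

theorem height_le_comap {B S : Type*} [CommRing B] [CommRing S] [Algebra B S]
    [Algebra.IsIntegral B S] (Q : Ideal S) [Q.IsPrime] :
    Q.height ≤ (Q.comap (algebraMap B S)).height := by
  have h1 := PrimeSpectrum.height_eq_orderHeight (⟨Q, inferInstance⟩ : PrimeSpectrum S)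
  have h2 := PrimeSpectrum.height_eq_orderHeight (⟨Q.comap (algebraMap B S), inferInstance⟩ : PrimeSpectrum B)
  dsimp only at h1 h2
  rw [h1, h2]
  refine Order.height_le_height_apply_of_strictMono
    (fun x : PrimeSpectrum S => PrimeSpectrum.comap (algebraMap B S) x) ?_ ⟨Q, inferInstance⟩
  intro x y hxy
  have hxy2 : x.1 < y.1 := hxy
  have := x.2
  exact Ideal.IsIntegral.comap_lt_comap hxy2

end CMBound

namespace CMBound
open Module RingTheory.Sequence IsLocalRing MvPolynomial

/-- the maximal ideal at the origin over `m`. -/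
noncomputable def originIdeal {R : Type*} [CommRing R] {n : ℕ}
    (B : Subalgebra R (MvPolynomial (Fin n) R)) (m : Ideal R) : Ideal B :=
  m.comap ((constantCoeff : MvPolynomial (Fin n) R →+* R).comp (algebraMap B (MvPolynomial (Fin n) R)))

theorem mem_originIdeal {R : Type*} [CommRing R] {n : ℕ}
    (B : Subalgebra R (MvPolynomial (Fin n) R)) (m : Ideal R) (b : B) :
    b ∈ originIdeal B m ↔ constantCoeff (b : MvPolynomial (Fin n) R) ∈ m := Iff.rfl

instance originIdeal_isMaximal {R : Type*} [CommRing R] {n : ℕ}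
    (B : Subalgebra R (MvPolynomial (Fin n) R)) (m : Ideal R) [m.IsMaximal] :
    (originIdeal B m).IsMaximal := by
  refine Ideal.comap_isMaximal_of_surjective _ fun r => ⟨algebraMap R B r, ?_⟩
  change constantCoeff (algebraMap R (MvPolynomial (Fin n) R) r) = r
  simp [algebraMap_eq]

theorem aeval_sub_mem {R B : Type*} [CommRing R] [CommRing B] [Algebra R B] {n : ℕ}
    (f : Fin n → B) (p : MvPolynomial (Fin n) R) :
    aeval f p - algebraMap R B (constantCoeff p) ∈ Ideal.span (Set.range f) := by
  rw [← Ideal.Quotient.eq]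
  induction p using MvPolynomial.induction_on with
  | C a => simp
  | add p q hp hq => simp only [map_add, hp, hq]
  | mul_X p i hp =>
    have : Ideal.Quotient.mk (Ideal.span (Set.range f)) (f i) = 0 :=
      Ideal.Quotient.eq_zero_iff_mem.2 (Ideal.subset_span ⟨i, rfl⟩)
    simp [this]

theorem prime_eq_origin {R : Type*} [CommRing R] {n : ℕ}
    (B : Subalgebra R (MvPolynomial (Fin n) R))
    (f : Fin n → B)
    (hInt : (aeval f : MvPolynomial (Fin n) R →ₐ[R] B).toRingHom.IsIntegral)
    (m : Ideal R) [m.IsMaximal] (as : List R)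
    (has : ∀ q : Ideal R, q.IsPrime → q ≤ m → (∀ r ∈ as, r ∈ q) → q = m)
    (Q : Ideal B) [hQ : Q.IsPrime] (hQP : Q ≤ originIdeal B m)
    (hfQ : ∀ i, f i ∈ Q) (haQ : ∀ a ∈ as, algebraMap R B a ∈ Q) : Q = originIdeal B m := by
  by_contra hne
  have hlt : Q < originIdeal B m := lt_of_le_of_ne hQP hne
  let _ := (aeval f : MvPolynomial (Fin n) R →ₐ[R] B).toRingHom.toAlgebra
  have : Algebra.IsIntegral (MvPolynomial (Fin n) R) B := ⟨hInt⟩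
  have h1 := Ideal.IsIntegral.comap_lt_comap (R := MvPolynomial (Fin n) R) hlt
  have hcomap : ∀ r, algebraMap R B r ∈ originIdeal B m ↔ r ∈ m := by
    intro r
    rw [mem_originIdeal]
    change constantCoeff (algebraMap R (MvPolynomial (Fin n) R) r) ∈ m ↔ _
    simp [algebraMap_eq]
  have hm : Q.comap (algebraMap R B) = m := by
    refine has _ inferInstance ?_ haQ
    intro r hr
    exact (hcomap r).1 (hQP hr)
  refine not_le_of_gt h1 ?_
  intro p hp
  have hp' : aeval f p ∈ originIdeal B m := hp
  change aeval f p ∈ Q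
  have hmem := aeval_sub_mem f p
  have hIQ : Ideal.span (Set.range f) ≤ Q := by
    rw [Ideal.span_le]; rintro _ ⟨i, rfl⟩; exact hfQ i
  have h2 : algebraMap R B (constantCoeff p) ∈ Q := by
    rw [← Ideal.mem_comap, hm, ← hcomap]
    have := Ideal.sub_mem _ hp' (hQP (hIQ hmem))
    simpa using this
  have := Ideal.add_mem _ (hIQ hmem) h2
  simpa using this

theorem support_sub {L : Type*} [CommRing L] [IsLocalRing L] (l : List L)
    (h : ∀ q : Ideal L, q.IsPrime → (∀ x ∈ l, x ∈ q) → q = maximalIdeal L) (k : ℕ) :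
    Module.supportDim L (L ⧸ (Ideal.ofList l • (⊤ : Submodule L L))) ≤ (k : ℕ) := by
  have key : ∀ q ∈ Module.support L (L ⧸ (Ideal.ofList l • (⊤ : Submodule L L))),
      q.asIdeal = maximalIdeal L := by
    intro q hq
    have h1 := Module.annihilator_le_of_mem_support hq
    refine h _ q.2 fun x hx => h1 ?_
    rw [Module.mem_annihilator]
    intro y
    obtain ⟨y, rfl⟩ := Submodule.Quotient.mk_surjective _ y
    rw [← Submodule.Quotient.mk_smul, Submodule.Quotient.mk_eq_zero]
    exact Submodule.smul_mem_smul (Ideal.subset_span hx) trivial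
  have hsub : (Module.support L (L ⧸ (Ideal.ofList l • (⊤ : Submodule L L)))).Subsingleton := by
    intro q hq q' hq'
    exact PrimeSpectrum.ext ((key q hq).trans (key q' hq').symm)
  have : Subsingleton (Module.support L (L ⧸ (Ideal.ofList l • (⊤ : Submodule L L)))) :=
    hsub.coe_sort
  refine le_trans (Order.krullDim_nonpos_of_subsingleton) ?_
  exact_mod_cast Nat.zero_le _

theorem local_reg0 {B : Type*} [CommRing B] [IsNoetherianRing B] (P : Ideal B) [P.IsPrime]
    (l : List B) (hlP : ∀ x ∈ l, x ∈ P) (hlen : ((l.length : ℕ) : ℕ∞) ≤ P.height)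
    (h : ∀ Q : Ideal B, Q.IsPrime → Q ≤ P → (∀ x ∈ l, x ∈ Q) → Q = P)
    (hCM : ∃ rs : List (Localization.AtPrime P),
      (∀ r ∈ rs, r ∈ maximalIdeal _) ∧ IsRegular (Localization.AtPrime P) rs ∧
      (rs.length : WithBot ℕ∞) = ringKrullDim (Localization.AtPrime P)) :
    IsWeaklyRegular (Localization.AtPrime P)
      (l.map (algebraMap B (Localization.AtPrime P))) := by
  obtain ⟨rs, hrs, hreg, hdim⟩ := hCM
  have hlen : (l.map (algebraMap B (Localization.AtPrime P))).length ≤ rs.length := by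
    have h1 : (rs.length : WithBot ℕ∞) = P.height := by
      rw [hdim, IsLocalization.AtPrime.ringKrullDim_eq_height P]
    have h1' : ((rs.length : ℕ) : ℕ∞) = P.height := by exact_mod_cast h1
    rw [← h1'] at hlen
    rw [List.length_map]
    exact_mod_cast hlen
  refine cm_list _ _ rs hrs hreg ?_ hlen (support_sub _ ?_ _)
  · intro r hr
    obtain ⟨x, hx, rfl⟩ := List.mem_map.1 hr
    exact (IsLocalization.AtPrime.to_map_mem_maximal_iff _ P x).2 (hlP x hx)
  · intro q hqp hq
    have hle : q.comap (algebraMap B (Localization.AtPrime P)) ≤ P := by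
      intro x hx
      have : algebraMap B (Localization.AtPrime P) x ∈ maximalIdeal _ :=
        IsLocalRing.le_maximalIdeal hqp.ne_top hx
      exact (IsLocalization.AtPrime.to_map_mem_maximal_iff _ P x).1 this
    have : Ideal.under B q = P := h _ inferInstance hle (fun x hx => hq _ (List.mem_map_of_mem hx))
    rw [← IsLocalization.map_under P.primeCompl _ q, this,
      Localization.AtPrime.map_eq_maximalIdeal]

theorem local_reg {R : Type*} [CommRing R] [IsNoetherianRing R] {n : ℕ}
    (B : Subalgebra R (MvPolynomial (Fin n) R)) [IsNoetherianRing B]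
    [Algebra.IsIntegral B (MvPolynomial (Fin n) R)]
    (f : Fin n → B) (hf0 : ∀ i, constantCoeff (f i : MvPolynomial (Fin n) R) = 0)
    (hInt : (aeval f : MvPolynomial (Fin n) R →ₐ[R] B).toRingHom.IsIntegral)
    (m : Ideal R) [m.IsMaximal] (as : List R) (ham : ∀ a ∈ as, a ∈ m)
    (hht : ((as.length : ℕ) : ℕ∞) ≤ m.height)
    (has : ∀ q : Ideal R, q.IsPrime → q ≤ m → (∀ r ∈ as, r ∈ q) → q = m)
    (hCM : ∃ rs : List (Localization.AtPrime (originIdeal B m)),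
      (∀ r ∈ rs, r ∈ maximalIdeal _) ∧ IsRegular (Localization.AtPrime (originIdeal B m)) rs ∧
      (rs.length : WithBot ℕ∞) = ringKrullDim (Localization.AtPrime (originIdeal B m))) :
    IsWeaklyRegular (Localization.AtPrime (originIdeal B m))
      ((List.ofFn f ++ as.map (algebraMap R B)).map
        (algebraMap B (Localization.AtPrime (originIdeal B m)))) := by
  have hcomap : ∀ r, algebraMap R B r ∈ originIdeal B m ↔ r ∈ m := by
    intro r
    rw [mem_originIdeal]
    change constantCoeff (algebraMap R (MvPolynomial (Fin n) R) r) ∈ m ↔ _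
    simp [algebraMap_eq]
  refine local_reg0 _ _ ?_ ?_ ?_ hCM
  · intro x hx
    rcases List.mem_append.1 hx with hx | hx
    · obtain ⟨i, rfl⟩ := (List.mem_ofFn).1 hx
      rw [mem_originIdeal, hf0]; exact m.zero_mem
    · obtain ⟨a, ha, rfl⟩ := List.mem_map.1 hx
      exact (hcomap a).2 (ham a ha)
  · have h2 := height_le_comap (B := B) (m.comap (constantCoeff : MvPolynomial (Fin n) R →+* R))
    rw [height_origin] at h2
    refine le_trans ?_ h2
    simp only [List.length_append, List.length_map, List.length_ofFn]
    push_cast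
    rw [add_comm]
    gcongr
  · intro Q hQ hQP hl
    exact prime_eq_origin B f hInt m as has _ hQP
      (fun i => hl _ (by rw [List.mem_append]; left; exact List.mem_ofFn.2 ⟨i, rfl⟩))
      (fun a ha => hl _ (by rw [List.mem_append]; right; exact List.mem_map_of_mem ha))

theorem exists_of_localization {B : Type*} [CommRing B] (P : Ideal B) [P.IsPrime]
    (l1 l2 : List B) (x : B)
    (h : IsWeaklyRegular (Localization.AtPrime P)
      ((l1 ++ x :: l2).map (algebraMap B (Localization.AtPrime P)))) (b : B)
    (hb : x * b ∈ Ideal.ofList l1) : ∃ s ∉ P, s * b ∈ Ideal.ofList l1 := by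
  rw [List.map_append, isWeaklyRegular_append_iff, List.map_cons, isWeaklyRegular_cons_iff] at h
  have h1 := h.2.1
  rw [isSMulRegular_quotient_iff_mem_of_smul_mem] at h1
  have h2 := h1 (algebraMap _ _ b)
  have e : Ideal.ofList (l1.map (algebraMap B (Localization.AtPrime P))) =
      (Ideal.ofList l1).map (algebraMap B (Localization.AtPrime P)) := by
    rw [Ideal.map_ofList]
  rw [smul_eq_mul, Ideal.mul_top, e, smul_eq_mul, ← map_mul,
    IsLocalization.algebraMap_mem_map_algebraMap_iff P.primeCompl,
    IsLocalization.algebraMap_mem_map_algebraMap_iff P.primeCompl] at h2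
  obtain ⟨s, hs, hs'⟩ := h2 ⟨1, P.primeCompl.one_mem, by simpa using hb⟩
  exact ⟨s, hs, hs'⟩
end CMBound

namespace CMBound
open Module RingTheory.Sequence IsLocalRing MvPolynomial

theorem hc_mul {R : Type*} [CommRing R] {σ : Type*} (a z : MvPolynomial σ R) (d k : ℕ)
    (hz : z.IsHomogeneous d) : homogeneousComponent k (a * z) =
      if d ≤ k then homogeneousComponent (k - d) a * z else 0 := by
  classical
  have h1 : ∀ i, homogeneousComponent k (homogeneousComponent i a * z) =
      if i + d = k then homogeneousComponent i a * z else 0 := by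
    intro i
    rw [homogeneousComponent_of_mem (m := k) (n := i + d)
      ((mem_homogeneousSubmodule _ _).2 ((homogeneousComponent_isHomogeneous i a).mul hz))]
    simp only [eq_comm]
  conv_lhs => rw [← sum_homogeneousComponent a, Finset.sum_mul, map_sum]
  simp_rw [h1]
  split_ifs with h
  · rw [Finset.sum_eq_single (k - d)]
    · rw [if_pos (by omega)]
    · intro i _ hi
      rw [if_neg (by omega)]
    · intro hi
      rw [if_pos (by omega), homogeneousComponent_eq_zero, zero_mul]
      rw [Finset.mem_range] at hi
      omega
  · refine Finset.sum_eq_zero fun i _ => ?_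
    rw [if_neg (by omega)]

theorem sum_hc {R : Type*} [CommRing R] {σ : Type*} (a : MvPolynomial σ R) :
    ∑ i ∈ Finset.range (a.totalDegree + 1), homogeneousComponent i a = a :=
  sum_homogeneousComponent a

/-- components on a graded subalgebra -/
noncomputable def hcB {R : Type*} [CommRing R] {n : ℕ} (B : Subalgebra R (MvPolynomial (Fin n) R))
    (hB : ∀ b ∈ B, ∀ k, homogeneousComponent k b ∈ B) (k : ℕ) : B →ₗ[R] B :=
  LinearMap.restrict (p := B.toSubmodule) (q := B.toSubmodule) (homogeneousComponent k)
    (fun b hb => hB b hb k)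

section
variable {R : Type*} [CommRing R] {n : ℕ} (B : Subalgebra R (MvPolynomial (Fin n) R))
    (hB : ∀ b ∈ B, ∀ k, homogeneousComponent k b ∈ B)

theorem hcB_coe (k : ℕ) (b : B) : (hcB B hB k b : MvPolynomial (Fin n) R) =
  homogeneousComponent k (b : MvPolynomial (Fin n) R) := rfl

theorem hcB_hom (k : ℕ) (b : B) : (hcB B hB k b : MvPolynomial (Fin n) R).IsHomogeneous k :=
  homogeneousComponent_isHomogeneous _ _

theorem hcB_mul (a z : B) (d k : ℕ)
    (hz : (z : MvPolynomial (Fin n) R).IsHomogeneous d) : hcB B hB k (a * z) =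
      if d ≤ k then hcB B hB (k - d) a * z else 0 := by
  apply Subtype.ext
  rw [hcB_coe, Subalgebra.coe_mul, hc_mul _ _ _ _ hz]
  split_ifs <;> simp [hcB_coe]

theorem hcB_sum (b : B) :
    ∑ i ∈ Finset.range ((b : MvPolynomial (Fin n) R).totalDegree + 1), hcB B hB i b = b := by
  apply Subtype.ext
  rw [AddSubmonoidClass.coe_finsetSum]
  exact sum_hc _

theorem hcB_self (b : B) (e : ℕ) (hb : (b : MvPolynomial (Fin n) R).IsHomogeneous e) :
    hcB B hB e b = b := by
  apply Subtype.ext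
  rw [hcB_coe, homogeneousComponent_eq_self hb]

theorem hcB_span (s : Set B) (hs : ∀ z ∈ s, ∃ d, (z : MvPolynomial (Fin n) R).IsHomogeneous d)
    (b : B) (hb : b ∈ Ideal.span s) (k : ℕ) : hcB B hB k b ∈ Ideal.span s := by
  induction hb using Submodule.closure_induction with
  | zero => simp
  | add x y _ _ hx hy => rw [map_add]; exact Ideal.add_mem _ hx hy
  | smul_mem r x hx =>
    obtain ⟨d, hd⟩ := hs x hx
    rw [smul_eq_mul, hcB_mul B hB _ _ d k hd]
    split_ifs
    · exact Ideal.mul_mem_left _ _ (Ideal.subset_span hx)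
    · exact zero_mem _

theorem mem_of_hcB (I : Ideal B) (b : B) (h : ∀ k, hcB B hB k b ∈ I) : b ∈ I := by
  rw [← hcB_sum B hB b]
  exact Ideal.sum_mem _ fun k _ => h k

theorem globalize0 (I : Ideal B) (hI : ∀ b ∈ I, ∀ k, hcB B hB k b ∈ I) (b : B) (e : ℕ)
    (hb : (b : MvPolynomial (Fin n) R).IsHomogeneous e)
    (h : ∀ m : Ideal R, m.IsMaximal → ∃ s ∉ originIdeal B m, s * b ∈ I) : b ∈ I := by
  let J : Ideal R := (I.restrictScalars R).comap (LinearMap.toSpanSingleton R B b)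
  have hJ : ∀ r, r ∈ J ↔ r • b ∈ I := fun r => Iff.rfl
  by_cases hJt : J = ⊤
  · have : (1 : R) ∈ J := hJt ▸ Submodule.mem_top
    rw [hJ, one_smul] at this
    exact this
  · obtain ⟨m, hm, hJm⟩ := Ideal.exists_le_maximal J hJt
    obtain ⟨s, hs, hsb⟩ := h m hm
    exfalso
    apply hs
    rw [mem_originIdeal]
    apply hJm
    rw [hJ]
    have h1 := hI _ hsb e
    rw [hcB_mul B hB _ _ e e hb, if_pos le_rfl, Nat.sub_self] at h1
    convert h1 using 1
    apply Subtype.ext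
    rw [Subalgebra.coe_mul, hcB_coe, homogeneousComponent_zero, ← smul_eq_C_mul]
    rfl

theorem globalize (I : Ideal B) (hI : ∀ b ∈ I, ∀ k, hcB B hB k b ∈ I) (x : B) (d : ℕ)
    (hx : (x : MvPolynomial (Fin n) R).IsHomogeneous d)
    (h : ∀ m : Ideal R, m.IsMaximal → ∀ b, x * b ∈ I → ∃ s ∉ originIdeal B m, s * b ∈ I)
    (b : B) (hb : x * b ∈ I) : b ∈ I := by
  refine mem_of_hcB B hB I b fun k => ?_
  refine globalize0 B hB I hI _ k (hcB_hom B hB k b) fun m hm => h m hm _ ?_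
  have h1 := hI _ hb (k + d)
  rw [mul_comm, hcB_mul B hB _ _ d (k + d) hx, if_pos (Nat.le_add_left _ _), Nat.add_sub_cancel] at h1
  rwa [mul_comm]
end

section
theorem cc_zero {R : Type*} [CommRing R] {n : ℕ}
    (B : Subalgebra R (MvPolynomial (Fin n) R))
    (f : Fin n → B) (d : Fin n → ℕ) (hd : ∀ i, 0 < d i)
    (hf : ∀ i, (f i : MvPolynomial (Fin n) R).IsHomogeneous (d i))
    (i : Fin n) : constantCoeff (f i : MvPolynomial (Fin n) R) = 0 := by
  rw [constantCoeff_eq]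
  refine (hf i).coeff_eq_zero ?_
  simp [(hd i).ne]

theorem ofList_hc {R : Type*} [CommRing R] [IsDomain R] [IsNoetherianRing R] {n : ℕ}
    (B : Subalgebra R (MvPolynomial (Fin n) R)) [IsNoetherianRing B]
    [Algebra.IsIntegral B (MvPolynomial (Fin n) R)]
    (hB : ∀ b ∈ B, ∀ k, homogeneousComponent k b ∈ B)
    (f : Fin n → B) (d : Fin n → ℕ)
    (hf : ∀ i, (f i : MvPolynomial (Fin n) R).IsHomogeneous (d i))
    (l : List B) (hl : ∀ x ∈ l, x ∈ List.ofFn f) :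
    ∀ b ∈ Ideal.ofList l, ∀ k, hcB B hB k b ∈ Ideal.ofList l := by
  intro b hb k
  refine hcB_span B hB _ ?_ b hb k
  intro z hz
  obtain ⟨i, rfl⟩ := List.mem_ofFn.1 (hl z hz)
  exact ⟨_, hf i⟩

theorem global_reg {R : Type*} [CommRing R] [IsDomain R] [IsNoetherianRing R] {n : ℕ}
    (B : Subalgebra R (MvPolynomial (Fin n) R)) [IsNoetherianRing B]
    [Algebra.IsIntegral B (MvPolynomial (Fin n) R)]
    (hB : ∀ b ∈ B, ∀ k, homogeneousComponent k b ∈ B)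
    (f : Fin n → B) (d : Fin n → ℕ) (hd : ∀ i, 0 < d i)
    (hf : ∀ i, (f i : MvPolynomial (Fin n) R).IsHomogeneous (d i))
    (hInt : (aeval f : MvPolynomial (Fin n) R →ₐ[R] B).toRingHom.IsIntegral)
    (hCM : ∀ (m : Ideal R) [m.IsMaximal], ∃ rs : List (Localization.AtPrime (originIdeal B m)),
      (∀ r ∈ rs, r ∈ maximalIdeal _) ∧ IsRegular (Localization.AtPrime (originIdeal B m)) rs ∧
      (rs.length : WithBot ℕ∞) = ringKrullDim (Localization.AtPrime (originIdeal B m))) : IsWeaklyRegular B (List.ofFn f) := by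
  rw [isWeaklyRegular_iff]
  intro i hi
  rw [isSMulRegular_quotient_iff_mem_of_smul_mem]
  intro b hb
  rw [smul_eq_mul, Ideal.mul_top] at hb ⊢
  have hi' : i < n := by simpa using hi
  refine globalize B hB _ (ofList_hc B hB f d hf _ fun x hx => List.mem_of_mem_take hx)
    ((List.ofFn f)[i]) (d ⟨i, hi'⟩) (by simpa using hf ⟨i, hi'⟩) ?_ b hb
  intro m hm b hb
  obtain ⟨as, h1, h2, h3⟩ := exists_params m
  have := local_reg B f (cc_zero B f d hd hf) hInt m as h1 h2 h3 (hCM m)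
  refine exists_of_localization _ ((List.ofFn f).take i)
    ((List.ofFn f).drop (i+1) ++ as.map (algebraMap R B)) ((List.ofFn f)[i]) ?_ b hb
  rw [← List.cons_append, ← List.append_assoc, ← List.drop_eq_getElem_cons hi, List.take_append_drop]
  exact this

theorem global_tf {R : Type*} [CommRing R] [IsDomain R] [IsNoetherianRing R] {n : ℕ}
    (B : Subalgebra R (MvPolynomial (Fin n) R)) [IsNoetherianRing B]
    [Algebra.IsIntegral B (MvPolynomial (Fin n) R)]
    (hB : ∀ b ∈ B, ∀ k, homogeneousComponent k b ∈ B)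
    (f : Fin n → B) (d : Fin n → ℕ) (hd : ∀ i, 0 < d i)
    (hf : ∀ i, (f i : MvPolynomial (Fin n) R).IsHomogeneous (d i))
    (hInt : (aeval f : MvPolynomial (Fin n) R →ₐ[R] B).toRingHom.IsIntegral)
    (hCM : ∀ (m : Ideal R) [m.IsMaximal], ∃ rs : List (Localization.AtPrime (originIdeal B m)),
      (∀ r ∈ rs, r ∈ maximalIdeal _) ∧ IsRegular (Localization.AtPrime (originIdeal B m)) rs ∧
      (rs.length : WithBot ℕ∞) = ringKrullDim (Localization.AtPrime (originIdeal B m)))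
    (a : R) (ha : a ≠ 0) (b : B) (hb : a • b ∈ Ideal.ofList (List.ofFn f)) :
    b ∈ Ideal.ofList (List.ofFn f) := by
  rw [Algebra.smul_def] at hb
  refine globalize B hB _ (ofList_hc B hB f d hf _ fun x hx => hx)
    (algebraMap R B a) 0 (isHomogeneous_C _ a) ?_ b hb
  intro m hm b hb
  by_cases ham : a ∈ m
  · obtain ⟨as, h1, h2, h3⟩ := exists_params_cons m a ham ha
    have := local_reg B f (cc_zero B f d hd hf) hInt m (a :: as) h1 h2 h3 (hCM m)
    rw [List.map_cons] at this
    exact exists_of_localization _ _ _ _ this b hb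
  · refine ⟨algebraMap R B a, ?_, hb⟩
    rw [mem_originIdeal]
    change constantCoeff (C a) ∉ m
    simpa using ham
end
end CMBound

namespace CMBound
open Module RingTheory.Sequence IsLocalRing MvPolynomial

open scoped Pointwise in
theorem reg_quot {C : Type*} [CommRing C] (r : C) (l : List C) (h : IsWeaklyRegular C (r :: l)) :
    IsWeaklyRegular (C ⧸ Ideal.span {r}) (l.map (Ideal.Quotient.mk (Ideal.span {r}))) := by
  have h1 := ((isWeaklyRegular_cons_iff _ _ _).1 h).2
  have e : (r • (⊤ : Submodule C C)) = Ideal.span {r} := by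
    rw [Submodule.ideal_span_singleton_smul r ⊤ |>.symm, smul_eq_mul, Ideal.mul_top]
  have h2 := (LinearEquiv.isWeaklyRegular_congr (Submodule.quotEquivOfEq _ _ e) l).1 h1
  exact (isWeaklyRegular_map_algebraMap_iff (C ⧸ Ideal.span {r}) (C ⧸ Ideal.span {r}) l).2 h2

theorem aeval_succ {R C : Type*} [CommRing R] [CommRing C] [Algebra R C] {k : ℕ}
    (f : Fin (k+1) → C) (p : MvPolynomial (Fin (k+1)) R) :
    aeval f p = Polynomial.eval₂RingHom
      (aeval (fun i : Fin k => f i.succ) : MvPolynomial (Fin k) R →ₐ[R] C).toRingHom (f 0)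
      (finSuccEquiv R k p) := by
  induction p using MvPolynomial.induction_on with
  | C a => simp [finSuccEquiv_apply]
  | add p q hp hq => simp only [map_add, hp, hq]
  | mul_X p i hp =>
    rw [map_mul, map_mul, map_mul, hp]
    congr 1
    refine Fin.cases ?_ ?_ i <;> simp [finSuccEquiv_apply]

theorem indep {R : Type*} [CommRing R] {ι : Type*} (s : Finset ι) (k : ℕ) :
    ∀ {C : Type*} [CommRing C] [Algebra R C] (f : Fin k → C) (b : ι → C)
    (_ : IsWeaklyRegular C (List.ofFn f))
    (_ : ∀ c : ι → R, ∑ j ∈ s, c j • b j ∈ Ideal.ofList (List.ofFn f) → ∀ j ∈ s, c j = 0)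
    (p : ι → MvPolynomial (Fin k) R) (_ : ∑ j ∈ s, aeval f (p j) * b j = 0), ∀ j ∈ s, p j = 0 := by
  induction k with
  | zero =>
    intro C _ _ f b hf hind p hp j hj
    have h0 : ∀ q : MvPolynomial (Fin 0) R, q = MvPolynomial.C (constantCoeff q) := by
      intro q
      obtain ⟨y, rfl⟩ := C_surjective (R := R) (Fin 0) q
      simp
    have := hind (fun j => constantCoeff (p j)) (by
      have : ∑ j ∈ s, constantCoeff (p j) • b j = ∑ j ∈ s, aeval f (p j) * b j := by
        refine Finset.sum_congr rfl fun j _ => ?_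
        conv_rhs => rw [h0 (p j)]
        rw [aeval_C, Algebra.smul_def]
      rw [this, hp]; exact zero_mem _) j hj
    rw [h0 (p j), this, map_zero]
  | succ k ih =>
    intro C _ _ f b hf hind p hp
    rw [List.ofFn_succ] at hf hind
    let ψ := Polynomial.eval₂RingHom
      (aeval (fun i : Fin k => f i.succ) : MvPolynomial (Fin k) R →ₐ[R] C).toRingHom (f 0)
    let π := Ideal.Quotient.mk (Ideal.span {f 0})
    have hπ : ∀ P, π (ψ P) = aeval (fun i : Fin k => π (f i.succ)) (P.coeff 0) := by
      intro P
      conv_lhs => rw [← Polynomial.X_mul_divX_add P]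
      have h1 : π (f 0) = 0 := Ideal.Quotient.eq_zero_iff_mem.2 (Ideal.mem_span_singleton_self _)
      have h2 : ∀ q : MvPolynomial (Fin k) R, π (aeval (fun i : Fin k => f i.succ) q) =
          aeval (fun i : Fin k => π (f i.succ)) q := by
        intro q
        have := comp_aeval_apply (fun i : Fin k => f i.succ) (Ideal.Quotient.mkₐ R (Ideal.span {f 0})) q
        exact this
      have h3 : ψ Polynomial.X = f 0 := by simp [ψ]
      have h4 : ∀ q, ψ (Polynomial.C q) = aeval (fun i : Fin k => f i.succ) q := by
        intro q; simp [ψ]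
      rw [map_add, map_mul, map_add, map_mul, h3, h1, zero_mul, zero_add, h4, h2]
    have hreg := ((isWeaklyRegular_cons_iff _ _ _).1 hf).1
    have hquot := reg_quot _ _ hf
    have hmap : (List.ofFn fun i : Fin k => f i.succ).map (Ideal.Quotient.mk (Ideal.span {f 0})) =
        List.ofFn fun i : Fin k => π (f i.succ) := by
      rw [List.map_ofFn]; rfl
    rw [hmap] at hquot
    have key : ∀ N : ℕ, ∀ P : ι → Polynomial (MvPolynomial (Fin k) R),
        (∀ j ∈ s, (P j).natDegree < N ∨ P j = 0) → ∑ j ∈ s, ψ (P j) * b j = 0 → ∀ j ∈ s, P j = 0 := by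
      intro N
      induction N with
      | zero =>
        intro P hP _ j hj
        simpa using hP j hj
      | succ N ihN =>
        intro P hP hsum
        have h0 := ih (fun i : Fin k => π (f i.succ)) (fun j => π (b j)) hquot (by
          intro c hc
          apply hind c
          rw [Ideal.ofList_cons, sup_comm, ← Ideal.mem_quotient_iff_mem_sup, Ideal.map_ofList, hmap]
          have : Ideal.Quotient.mk (Ideal.span {f 0}) (∑ j ∈ s, c j • b j) =
              ∑ j ∈ s, c j • π (b j) := by
            rw [map_sum]; rfl
          rw [this]; exact hc) (fun j => (P j).coeff 0) (by
          have := congrArg π hsum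
          rw [map_sum, map_zero] at this
          rw [← this]
          refine Finset.sum_congr rfl fun j _ => ?_
          rw [map_mul, hπ])
        have hX : ∀ j ∈ s, P j = Polynomial.X * (P j).divX := by
          intro j hj
          conv_lhs => rw [← Polynomial.X_mul_divX_add (P j), h0 j hj, map_zero, add_zero]
        have h1 := ihN (fun j => (P j).divX) (by
          intro j hj
          rcases hP j hj with h | h
          · by_cases hz : (P j).divX = 0
            · right; exact hz
            · left
              rw [Polynomial.natDegree_divX_eq_natDegree_tsub_one]
              have : (P j).natDegree ≠ 0 := by
                intro h'
                apply hz
                rw [Polynomial.divX_eq_zero_iff, ← Polynomial.eq_C_of_natDegree_eq_zero h']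
              omega
          · right; rw [h, Polynomial.divX_zero]) (by
          apply hreg
          change f 0 • _ = f 0 • (0 : C)
          rw [smul_zero, smul_eq_mul, Finset.mul_sum, ← hsum]
          refine Finset.sum_congr rfl fun j hj => ?_
          conv_rhs => rw [hX j hj, map_mul]
          have h3 : ψ Polynomial.X = f 0 := by simp [ψ]
          rw [h3, mul_assoc])
        intro j hj
        rw [hX j hj, h1 j hj, mul_zero]
    intro j hj
    have := key ((s.sup fun j => (finSuccEquiv R k (p j)).natDegree) + 1)
      (fun j => finSuccEquiv R k (p j))
      (fun j hj => Or.inl (Nat.lt_succ_of_le (Finset.le_sup (f := fun j => (finSuccEquiv R k (p j)).natDegree) hj)))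
      (by rw [← hp]; exact Finset.sum_congr rfl fun j _ => by rw [aeval_succ]) j hj
    simpa using this
end CMBound

namespace CMBound
open Module RingTheory.Sequence IsLocalRing MvPolynomial

theorem reg_ringEquiv {A B : Type*} [CommRing A] [CommRing B] (e : A ≃+* B) (l : List A) :
    IsWeaklyRegular A l ↔ IsWeaklyRegular B (l.map e) :=
  AddEquiv.isWeaklyRegular_congr (e := e.toAddEquiv) <| List.forall₂_map_right_iff.mpr <|
    List.forall₂_same.mpr fun r _ x => by simp

theorem X_reg (R : Type*) [CommRing R] (n : ℕ) :
    IsWeaklyRegular (MvPolynomial (Fin n) R) (List.ofFn (X : Fin n → MvPolynomial (Fin n) R)) := by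
  rw [isWeaklyRegular_iff]
  intro i hi
  have hi' : i < n := by simpa using hi
  rw [isSMulRegular_quotient_iff_mem_of_smul_mem]
  intro b hb
  rw [smul_eq_mul, Ideal.mul_top] at hb ⊢
  have e : Ideal.ofList ((List.ofFn (X : Fin n → MvPolynomial (Fin n) R)).take i) =
      Ideal.span (X '' {j : Fin n | j.1 < i}) := by
    unfold Ideal.ofList
    congr 1
    ext x
    simp only [Set.mem_ofPred_eq, Set.mem_image, List.mem_take_iff_getElem]
    constructor
    · rintro ⟨j, hj, rfl⟩
      rw [lt_min_iff] at hj
      exact ⟨⟨j, by omega⟩, hj.1, by simp⟩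
    · rintro ⟨j, hj, rfl⟩
      exact ⟨j, by simp [hj], by simp⟩
  rw [e, mem_ideal_span_X_image] at hb ⊢
  intro m hm
  have h1 : m + Finsupp.single ⟨i, hi'⟩ 1 ∈ ((List.ofFn (X : Fin n → MvPolynomial (Fin n) R))[i] • b).support := by
    rw [List.getElem_ofFn, smul_eq_mul, mul_comm, MvPolynomial.mem_support_iff, coeff_mul_X]
    exact MvPolynomial.mem_support_iff.1 hm
  obtain ⟨j, hj, hj'⟩ := hb _ h1
  refine ⟨j, hj, ?_⟩
  rw [Finsupp.add_apply, Finsupp.single_apply, if_neg] at hj'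
  · simpa using hj'
  · rintro rfl
    simp at hj

theorem field_reg {K : Type*} [Field K] {n : ℕ} (f : Fin n → MvPolynomial (Fin n) K)
    (d : Fin n → ℕ) (hd : ∀ i, 0 < d i) (hf : ∀ i, (f i).IsHomogeneous (d i))
    (hInt : (aeval f : MvPolynomial (Fin n) K →ₐ[K] MvPolynomial (Fin n) K).toRingHom.IsIntegral) :
    IsWeaklyRegular (MvPolynomial (Fin n) K) (List.ofFn f) := by
  let e : MvPolynomial (Fin n) K ≃ₐ[K] (⊤ : Subalgebra K (MvPolynomial (Fin n) K)) :=
    Subalgebra.topEquiv.symm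
  have hN : IsNoetherianRing (⊤ : Subalgebra K (MvPolynomial (Fin n) K)) :=
    isNoetherianRing_of_ringEquiv _ e.toRingEquiv
  have hI : Algebra.IsIntegral (⊤ : Subalgebra K (MvPolynomial (Fin n) K)) (MvPolynomial (Fin n) K) := by
    refine ⟨fun x => ?_⟩
    exact isIntegral_algebraMap (R := (⊤ : Subalgebra K (MvPolynomial (Fin n) K))) (x := ⟨x, trivial⟩)
  have key := global_reg (⊤ : Subalgebra K (MvPolynomial (Fin n) K)) (fun _ _ _ => trivial)
    (fun i => e (f i)) d hd hf ?_ ?_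
  · rw [reg_ringEquiv e.toRingEquiv, List.map_ofFn]
    exact key
  · intro x
    obtain ⟨p, hp, hp'⟩ := hInt (e.symm x)
    refine ⟨p, hp, ?_⟩
    have : (aeval (fun i => e (f i)) : MvPolynomial (Fin n) K →ₐ[K] _).toRingHom =
        e.toRingEquiv.toRingHom.comp (aeval f : MvPolynomial (Fin n) K →ₐ[K] MvPolynomial (Fin n) K).toRingHom := by
      refine MvPolynomial.ringHom_ext (fun r => ?_) (fun i => ?_)
      · apply Subtype.ext
        have h2 := congrArg Subtype.val (e.commutes r)
        simpa using h2.symm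
      · simp
    rw [this]
    have h2 := congrArg e.toRingEquiv.toRingHom hp'
    rw [Polynomial.hom_eval₂] at h2
    simpa using h2
  · intro m hm
    have hm0 : m = ⊥ := Ideal.eq_bot_of_prime m
    have hmem : ∀ r ∈ List.ofFn (fun i => e (X i)), r ∈ originIdeal (⊤ : Subalgebra K (MvPolynomial (Fin n) K)) m := by
      intro r hr
      obtain ⟨i, rfl⟩ := List.mem_ofFn.1 hr
      rw [mem_originIdeal]
      change constantCoeff (X i) ∈ m
      rw [constantCoeff_X]; exact m.zero_mem
    have hX : IsWeaklyRegular (⊤ : Subalgebra K (MvPolynomial (Fin n) K)) (List.ofFn (fun i => e (X i))) := by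
      have := (reg_ringEquiv e.toRingEquiv _).1 (X_reg K n)
      rw [List.map_ofFn] at this
      exact this
    refine ⟨(List.ofFn (fun i => e (X i))).map (algebraMap _ _), ?_,
      hX.isRegular_of_isLocalization_of_mem _ (originIdeal (⊤ : Subalgebra K (MvPolynomial (Fin n) K)) m) hmem, ?_⟩
    · intro r hr
      obtain ⟨x, hx, rfl⟩ := List.mem_map.1 hr
      exact (IsLocalization.AtPrime.to_map_mem_maximal_iff _ _ x).2 (hmem x hx)
    · refine Eq.trans ?_ (IsLocalization.AtPrime.ringKrullDim_eq_height
        (originIdeal (⊤ : Subalgebra K (MvPolynomial (Fin n) K)) m)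
        (Localization.AtPrime (originIdeal (⊤ : Subalgebra K (MvPolynomial (Fin n) K)) m))).symm
      have h1 : originIdeal (⊤ : Subalgebra K (MvPolynomial (Fin n) K)) m =
          (m.comap constantCoeff).comap e.symm.toRingEquiv := rfl
      rw [List.length_map, List.length_ofFn, h1, RingEquiv.height_comap, height_origin, hm0]
      simp
end CMBound

namespace CMBound
open Module RingTheory.Sequence IsLocalRing MvPolynomial

section
variable {K : Type*} [Field K] {n : ℕ}

/-- graded piece of an ideal -/
noncomputable def gp (I : Ideal (MvPolynomial (Fin n) K)) (e : ℕ) : Submodule K (MvPolynomial (Fin n) K) :=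
  I.restrictScalars K ⊓ homogeneousSubmodule (Fin n) K e

instance fin_hs (e : ℕ) : FiniteDimensional K (homogeneousSubmodule (Fin n) K e) :=
  Module.Finite.of_fg (homogeneousSubmodule_fg (Fin n) K e)

instance fin_gp (I : Ideal (MvPolynomial (Fin n) K)) (e : ℕ) : FiniteDimensional K (gp I e) :=
  Submodule.finiteDimensional_of_le (inf_le_right : gp I e ≤ homogeneousSubmodule (Fin n) K e)

theorem mem_gp (I : Ideal (MvPolynomial (Fin n) K)) (e : ℕ) (x : MvPolynomial (Fin n) K) :
    x ∈ gp I e ↔ x ∈ I ∧ x.IsHomogeneous e := Iff.rfl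

/-- Hilbert series of the quotient -/
noncomputable def hs (I : Ideal (MvPolynomial (Fin n) K)) : PowerSeries ℤ :=
  PowerSeries.mk fun e => (finrank K (homogeneousSubmodule (Fin n) K e) : ℤ) - finrank K (gp I e)

theorem hs_step (I : Ideal (MvPolynomial (Fin n) K))
    (hI : ∀ b ∈ I, ∀ k, homogeneousComponent k b ∈ I) (g : MvPolynomial (Fin n) K) (d : ℕ)
    (hg : g.IsHomogeneous d) (hg0 : g ≠ 0) (hreg : ∀ b, g * b ∈ I → b ∈ I) :
    hs (I ⊔ Ideal.span {g}) = (1 - PowerSeries.X ^ d) * hs I := by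
  have hcomp : ∀ b ∈ I ⊔ Ideal.span {g}, ∀ k, ∃ i ∈ I, ∃ a, i.IsHomogeneous k ∧ 
      homogeneousComponent k b = i + (if d ≤ k then homogeneousComponent (k - d) a * g else 0) := by
    intro b hb k
    obtain ⟨i, hi, y, hy, rfl⟩ := Submodule.mem_sup.1 hb
    obtain ⟨a, rfl⟩ := Ideal.mem_span_singleton'.1 hy
    refine ⟨_, hI i hi k, a, homogeneousComponent_isHomogeneous _ _, ?_⟩
    rw [map_add, hc_mul _ _ d k hg]
  ext e
  rw [sub_mul, one_mul, map_sub, PowerSeries.coeff_X_pow_mul']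
  unfold hs
  rw [PowerSeries.coeff_mk, PowerSeries.coeff_mk]
  split_ifs with h
  · rw [PowerSeries.coeff_mk]
    let M : MvPolynomial (Fin n) K →ₗ[K] MvPolynomial (Fin n) K := LinearMap.mulRight K g
    have hM : Function.Injective M := fun x y hxy => mul_right_cancel₀ hg0 hxy
    have h1 : gp (I ⊔ Ideal.span {g}) e = gp I e ⊔ (homogeneousSubmodule (Fin n) K (e - d)).map M := by
      apply le_antisymm
      · rintro x ⟨hx, hxe⟩
        obtain ⟨i, hi, a, hih, heq⟩ := hcomp x hx e
        rw [if_pos h, homogeneousComponent_eq_self hxe] at heq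
        rw [heq]
        exact Submodule.add_mem_sup ⟨hi, hih⟩
          (Submodule.mem_map_of_mem (f := M) (homogeneousComponent_mem (e - d) a))
      · refine sup_le ?_ ?_
        · rintro x ⟨hx, hxe⟩
          exact ⟨Ideal.mem_sup_left hx, hxe⟩
        · rintro _ ⟨x, hx, rfl⟩
          refine ⟨Ideal.mem_sup_right (Ideal.mem_span_singleton'.2 ⟨x, rfl⟩), ?_⟩
          have := ((mem_homogeneousSubmodule _ _).1 hx).mul hg
          rw [Nat.sub_add_cancel h] at this
          exact this
    have h2 : gp I e ⊓ (homogeneousSubmodule (Fin n) K (e - d)).map M = (gp I (e - d)).map M := by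
      apply le_antisymm
      · rintro _ ⟨⟨hx, hxe⟩, y, hy, rfl⟩
        refine ⟨y, ⟨hreg y ?_, hy⟩, rfl⟩
        rw [mul_comm]; exact hx
      · rintro _ ⟨y, ⟨hy, hyh⟩, rfl⟩
        refine ⟨⟨Ideal.mul_mem_right _ _ hy, ?_⟩, y, hyh, rfl⟩
        have := ((mem_homogeneousSubmodule _ _).1 hyh).mul hg
        rw [Nat.sub_add_cancel h] at this
        exact this
    have h3 := Submodule.finrank_sup_add_finrank_inf_eq (gp I e) ((homogeneousSubmodule (Fin n) K (e - d)).map M)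
    rw [← h1, h2, LinearEquiv.finrank_eq (Submodule.equivMapOfInjective M hM _).symm,
      LinearEquiv.finrank_eq (Submodule.equivMapOfInjective M hM _).symm] at h3
    zify at h3
    linarith
  · have h1 : gp (I ⊔ Ideal.span {g}) e = gp I e := by
      apply le_antisymm
      · rintro x ⟨hx, hxe⟩
        obtain ⟨i, hi, a, hih, heq⟩ := hcomp x hx e
        rw [if_neg h, homogeneousComponent_eq_self hxe, add_zero] at heq
        rw [heq]
        exact ⟨hi, hih⟩
      · rintro x ⟨hx, hxe⟩
        exact ⟨Ideal.mem_sup_left hx, hxe⟩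
    rw [h1, sub_zero]

theorem span_hc (s : Set (MvPolynomial (Fin n) K)) (hs : ∀ z ∈ s, ∃ d, z.IsHomogeneous d)
    (b : MvPolynomial (Fin n) K) (hb : b ∈ Ideal.span s) (k : ℕ) :
    homogeneousComponent k b ∈ Ideal.span s := by
  induction hb using Submodule.closure_induction with
  | zero => simp
  | add x y _ _ hx hy => rw [map_add]; exact Ideal.add_mem _ hx hy
  | smul_mem r x hx =>
    obtain ⟨d, hd⟩ := hs x hx
    rw [smul_eq_mul, hc_mul _ _ d k hd]
    split_ifs
    · exact Ideal.mul_mem_left _ _ (Ideal.subset_span hx)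
    · exact zero_mem _

theorem hs_list (L : List (MvPolynomial (Fin n) K × ℕ)) (hL : ∀ p ∈ L, p.1.IsHomogeneous p.2 ∧ p.1 ≠ 0)
    (hreg : IsWeaklyRegular (MvPolynomial (Fin n) K) (L.map Prod.fst)) :
    hs (Ideal.ofList (L.map Prod.fst)) =
      (L.map fun p => (1 - PowerSeries.X ^ p.2 : PowerSeries ℤ)).prod * hs (⊥ : Ideal (MvPolynomial (Fin n) K)) := by
  induction L using List.reverseRecOn with
  | nil => simp
  | append_singleton L p ih =>
    rw [List.map_append, isWeaklyRegular_append_iff, List.map_singleton, isWeaklyRegular_singleton_iff,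
      isSMulRegular_quotient_iff_mem_of_smul_mem] at hreg
    have hp := hL p (by simp)
    have hL' : ∀ p ∈ L, p.1.IsHomogeneous p.2 ∧ p.1 ≠ 0 := fun q hq => hL q (by simp [hq])
    rw [List.map_append, List.map_singleton, Ideal.ofList_append, Ideal.ofList_singleton,
      hs_step _ _ p.1 p.2 hp.1 hp.2, ih hL' hreg.1]
    · rw [List.map_append, List.prod_append, List.map_singleton, List.prod_singleton]; ring
    · intro b hb
      have := hreg.2 b
      rw [smul_eq_mul, Ideal.mul_top, smul_eq_mul] at this
      exact this hb
    · intro b hb k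
      refine span_hc _ ?_ b hb k
      intro z hz
      obtain ⟨q, hq, rfl⟩ := List.mem_map.1 hz
      exact ⟨_, (hL' q hq).1⟩

theorem hs_ofFn (f : Fin n → MvPolynomial (Fin n) K) (d : Fin n → ℕ)
    (hf : ∀ i, (f i).IsHomogeneous (d i)) (hf0 : ∀ i, f i ≠ 0)
    (hreg : IsWeaklyRegular (MvPolynomial (Fin n) K) (List.ofFn f)) :
    hs (Ideal.ofList (List.ofFn f)) =
      (∏ i, (1 - PowerSeries.X ^ d i : PowerSeries ℤ)) * hs (⊥ : Ideal (MvPolynomial (Fin n) K)) := by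
  have := hs_list (List.ofFn fun i => (f i, d i)) (by
    intro p hp
    obtain ⟨i, rfl⟩ := List.mem_ofFn.1 hp
    exact ⟨hf i, hf0 i⟩) (by rw [List.map_ofFn]; exact hreg)
  rw [List.map_ofFn, List.map_ofFn, List.prod_ofFn] at this
  exact this

theorem hs_X : hs (Ideal.ofList (List.ofFn (X : Fin n → MvPolynomial (Fin n) K))) = 1 := by
  have hmem : ∀ p : MvPolynomial (Fin n) K, p ∈ Ideal.ofList (List.ofFn (X : Fin n → MvPolynomial (Fin n) K)) ↔
      constantCoeff p = 0 := by
    intro p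
    have : Ideal.ofList (List.ofFn (X : Fin n → MvPolynomial (Fin n) K)) =
        Ideal.span (X '' Set.univ) := by
      unfold Ideal.ofList
      congr 1
      ext x
      simp [List.mem_ofFn]
    rw [this, mem_ideal_span_X_image, constantCoeff_eq]
    constructor
    · intro h
      by_contra h0
      obtain ⟨i, _, hi⟩ := h 0 (MvPolynomial.mem_support_iff.2 h0)
      exact hi rfl
    · intro h m hm
      by_contra! h'
      have : m = 0 := by ext i; simpa using h' i trivial
      rw [this, MvPolynomial.mem_support_iff] at hm
      exact hm h
  ext e
  unfold hs
  rw [PowerSeries.coeff_mk, PowerSeries.coeff_one]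
  split_ifs with he
  · subst he
    have h1 : gp (Ideal.ofList (List.ofFn (X : Fin n → MvPolynomial (Fin n) K))) 0 = ⊥ := by
      rw [eq_bot_iff]
      rintro x ⟨hx, hx0⟩
      have hx1 := (hmem x).1 hx
      have hx2 := homogeneousComponent_eq_self ((mem_homogeneousSubmodule _ _).1 hx0)
      rw [homogeneousComponent_zero] at hx2
      rw [constantCoeff_eq] at hx1
      rw [← hx2, hx1]
      simp
    have h2 : finrank K (homogeneousSubmodule (Fin n) K 0) = 1 := by
      rw [homogeneousSubmodule_zero]
      rw [Submodule.one_eq_span]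
      exact finrank_span_singleton one_ne_zero
    rw [h1, h2]; simp
  · have h1 : gp (Ideal.ofList (List.ofFn (X : Fin n → MvPolynomial (Fin n) K))) e =
        homogeneousSubmodule (Fin n) K e := by
      refine le_antisymm inf_le_right fun x hx => ⟨(hmem x).2 ?_, hx⟩
      rw [constantCoeff_eq]
      refine ((mem_homogeneousSubmodule _ _).1 hx).coeff_eq_zero ?_
      simpa using Ne.symm he
    rw [h1, sub_self]

theorem macaulay (f : Fin n → MvPolynomial (Fin n) K) (d : Fin n → ℕ) (hd : ∀ i, 0 < d i)
    (hf : ∀ i, (f i).IsHomogeneous (d i)) (hf0 : ∀ i, f i ≠ 0)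
    (hInt : (aeval f : MvPolynomial (Fin n) K →ₐ[K] MvPolynomial (Fin n) K).toRingHom.IsIntegral)
    (e : ℕ) (he : ∑ i, (d i - 1) < e) (x : MvPolynomial (Fin n) K) (hx : x.IsHomogeneous e) :
    x ∈ Ideal.span (Set.range f) := by
  have h1 := hs_ofFn f d hf hf0 (field_reg f d hd hf hInt)
  have h2 := hs_ofFn (X : Fin n → MvPolynomial (Fin n) K) (fun _ => 1) (fun i => isHomogeneous_X _ i)
    (fun i => X_ne_zero i) (X_reg K n)
  rw [hs_X] at h2
  let g : Polynomial ℤ := ∏ i, ∑ j ∈ Finset.range (d i), Polynomial.X ^ j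
  have h3 : (∏ i, (1 - PowerSeries.X ^ d i : PowerSeries ℤ)) =
      (∏ i : Fin n, (1 - PowerSeries.X ^ 1 : PowerSeries ℤ)) * (g : PowerSeries ℤ) := by
    have : (g : PowerSeries ℤ) = ∏ i, ∑ j ∈ Finset.range (d i), PowerSeries.X ^ j := by
      change Polynomial.coeToPowerSeries.ringHom g = _
      simp only [g, map_prod, map_sum, map_pow]
      simp
    rw [this, ← Finset.prod_mul_distrib]
    refine Finset.prod_congr rfl fun i _ => ?_
    rw [pow_one, mul_neg_geom_sum]
  have h4 : hs (Ideal.ofList (List.ofFn f)) = (g : PowerSeries ℤ) := by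
    rw [h1, h3, mul_right_comm, ← h2, one_mul]
  have h5 : PowerSeries.coeff e (hs (Ideal.ofList (List.ofFn f))) = 0 := by
    rw [h4, Polynomial.coeff_coe]
    apply Polynomial.coeff_eq_zero_of_natDegree_lt
    refine lt_of_le_of_lt (Polynomial.natDegree_prod_le _ _) (lt_of_le_of_lt (Finset.sum_le_sum fun i _ => ?_) he)
    refine Polynomial.natDegree_sum_le_of_forall_le _ _ fun j hj => ?_
    rw [Polynomial.natDegree_X_pow]
    have := Finset.mem_range.1 hj
    omega
  unfold hs at h5
  rw [PowerSeries.coeff_mk, sub_eq_zero] at h5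
  have h6 : gp (Ideal.ofList (List.ofFn f)) e = homogeneousSubmodule (Fin n) K e :=
    Submodule.eq_of_le_of_finrank_eq inf_le_right (by exact_mod_cast h5.symm)
  have h7 : x ∈ gp (Ideal.ofList (List.ofFn f)) e := by rw [h6]; exact hx
  have h8 : Ideal.ofList (List.ofFn f) = Ideal.span (Set.range f) := by
    unfold Ideal.ofList
    congr 1
    ext x
    simp [List.mem_ofFn]
  rw [← h8]
  exact h7.1
end
end CMBound

namespace CMBound
open Module RingTheory.Sequence IsLocalRing MvPolynomial

section
variable {R : Type*} [CommRing R] {n : ℕ}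

theorem spanR_hc (W : Set (MvPolynomial (Fin n) R)) (hW : ∀ z ∈ W, ∃ e, z.IsHomogeneous e)
    (t : MvPolynomial (Fin n) R) (ht : t ∈ Submodule.span R W) (k : ℕ) :
    homogeneousComponent k t ∈ Submodule.span R W := by
  induction ht using Submodule.span_induction with
  | mem x hx =>
    obtain ⟨e, he⟩ := hW x hx
    rw [homogeneousComponent_of_mem ((mem_homogeneousSubmodule _ _).2 he)]
    split_ifs
    · exact Submodule.subset_span hx
    · exact zero_mem _
  | zero => simp
  | add x y _ _ hx hy => rw [map_add]; exact add_mem hx hy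
  | smul a x _ hx => rw [map_smul]; exact Submodule.smul_mem _ _ hx

theorem smulR_mem {A : Subalgebra R (MvPolynomial (Fin n) R)} (T : Submodule A (MvPolynomial (Fin n) R))
    (r : R) {x : MvPolynomial (Fin n) R} (hx : x ∈ T) : r • x ∈ T := by
  have := T.smul_mem (algebraMap R A r) hx
  rwa [algebraMap_smul] at this

theorem ascend (B : Subalgebra R (MvPolynomial (Fin n) R))
    (hB : ∀ b ∈ B, ∀ k, homogeneousComponent k b ∈ B)
    (f : Fin n → MvPolynomial (Fin n) R) (d : Fin n → ℕ) (hd : ∀ i, 0 < d i)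
    (hf : ∀ i, (f i).IsHomogeneous (d i)) (Λ : Submonoid R)
    (W : Set (MvPolynomial (Fin n) R)) (hW : ∀ z ∈ W, ∃ e, z.IsHomogeneous e) (M : ℕ)
    (H : ∀ e ≤ M, ∀ b ∈ B, b.IsHomogeneous e → ∃ r ∈ Λ, ∃ t ∈ Submodule.span R W,
      ∃ g : Fin n → MvPolynomial (Fin n) R, (∀ i, g i ∈ B) ∧ r • b = t + ∑ i, g i * f i) :
    ∀ e ≤ M, ∀ b ∈ B, b.IsHomogeneous e →
      ∃ r ∈ Λ, r • b ∈ Submodule.span (Algebra.adjoin R (Set.range f)) W := by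
  intro e
  induction e using Nat.strong_induction_on with
  | _ e ih =>
  intro heM b hb hbe
  obtain ⟨r, hr, t, ht, g, hg, heq⟩ := H e heM b hb hbe
  have h1 := congrArg (homogeneousComponent e) heq
  rw [map_smul, homogeneousComponent_eq_self hbe, map_add, map_sum] at h1
  have h2 : ∀ i, ∃ ρ ∈ Λ, ρ • homogeneousComponent e (g i * f i) ∈
      Submodule.span (Algebra.adjoin R (Set.range f)) W := by
    intro i
    rw [hc_mul _ _ (d i) e (hf i)]
    split_ifs with h
    · obtain ⟨ρ, hρ, hρ'⟩ := ih (e - d i) (by have := hd i; omega) (by omega) _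
        (hB _ (hg i) (e - d i)) (homogeneousComponent_isHomogeneous _ _)
      refine ⟨ρ, hρ, ?_⟩
      have := Submodule.smul_mem _ (⟨f i, Algebra.subset_adjoin ⟨i, rfl⟩⟩ : Algebra.adjoin R (Set.range f)) hρ'
      rw [Subalgebra.smul_def, smul_eq_mul, mul_comm, smul_mul_assoc] at this
      exact this
    · exact ⟨1, Λ.one_mem, by rw [smul_zero]; exact zero_mem _⟩
  choose ρ hρ hρ' using h2
  refine ⟨(∏ i, ρ i) * r, Λ.mul_mem (Λ.prod_mem fun i _ => hρ i) hr, ?_⟩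
  rw [mul_smul, h1, smul_add, Finset.smul_sum]
  refine add_mem (smulR_mem _ _ ?_) (sum_mem fun i _ => ?_)
  · have := Submodule.span_le_restrictScalars R (Algebra.adjoin R (Set.range f)) W
    exact this (spanR_hc W hW t ht e)
  · rw [← Finset.prod_erase_mul _ _ (Finset.mem_univ i), mul_smul]
    exact smulR_mem _ _ (hρ' i)

theorem good_of_hom (Λ : Submonoid R) {A : Subalgebra R (MvPolynomial (Fin n) R)}
    (T : Submodule A (MvPolynomial (Fin n) R)) (b : MvPolynomial (Fin n) R)
    (h : ∀ e, ∃ r ∈ Λ, r • homogeneousComponent e b ∈ T) : ∃ r ∈ Λ, r • b ∈ T := by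
  choose ρ hρ hρ' using h
  refine ⟨∏ i ∈ Finset.range (b.totalDegree + 1), ρ i, Λ.prod_mem fun i _ => hρ i, ?_⟩
  have hs : (∏ i ∈ Finset.range (b.totalDegree + 1), ρ i) • b =
      ∑ j ∈ Finset.range (b.totalDegree + 1),
        (∏ i ∈ Finset.range (b.totalDegree + 1), ρ i) • homogeneousComponent j b := by
    rw [← Finset.smul_sum, sum_homogeneousComponent b]
  rw [hs]
  refine sum_mem fun i hi => ?_
  rw [← Finset.prod_erase_mul _ _ hi, mul_smul]
  exact smulR_mem _ _ (hρ' i)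
end

theorem map_integral {R : Type*} [CommRing R] (K : Type*) [Field K] [Algebra R K] {n : ℕ}
    (f : Fin n → MvPolynomial (Fin n) R)
    (hInt : (aeval f : MvPolynomial (Fin n) R →ₐ[R] MvPolynomial (Fin n) R).toRingHom.IsIntegral) :
    (aeval (fun i => map (algebraMap R K) (f i)) :
      MvPolynomial (Fin n) K →ₐ[K] MvPolynomial (Fin n) K).toRingHom.IsIntegral := by
  intro x
  set φ := (aeval (fun i => map (algebraMap R K) (f i)) :
      MvPolynomial (Fin n) K →ₐ[K] MvPolynomial (Fin n) K).toRingHom with hφ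
  induction x using MvPolynomial.induction_on with
  | C a =>
    have := φ.isIntegralElem_map (x := C a)
    simpa [hφ] using this
  | add p q hp hq => exact RingHom.IsIntegralElem.add φ hp hq
  | mul_X p i hp =>
    refine RingHom.IsIntegralElem.mul φ hp ?_
    obtain ⟨q, hq, hq'⟩ := hInt (X i)
    refine ⟨q.map (map (algebraMap R K)), hq.map _, ?_⟩
    have h2 := congrArg (map (algebraMap R K)) hq'
    rw [Polynomial.hom_eval₂, map_X, map_zero] at h2
    rw [Polynomial.eval₂_map, ← h2]
    congr 1
    refine MvPolynomial.ringHom_ext (fun r => ?_) (fun i => ?_)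
    · simp [hφ]
    · simp [hφ]

theorem torsion_mem {R : Type*} [CommRing R] [IsDomain R] {n : ℕ}
    (f : Fin n → MvPolynomial (Fin n) R) (d : Fin n → ℕ) (hd : ∀ i, 0 < d i)
    (hf : ∀ i, (f i).IsHomogeneous (d i)) (hf0 : ∀ i, f i ≠ 0)
    (hInt : (aeval f : MvPolynomial (Fin n) R →ₐ[R] MvPolynomial (Fin n) R).toRingHom.IsIntegral)
    (e : ℕ) (he : ∑ i, (d i - 1) < e) (x : MvPolynomial (Fin n) R) (hx : x.IsHomogeneous e) :
    ∃ r ∈ nonZeroDivisors R, r • x ∈ Ideal.span (Set.range f) := by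
  let K := FractionRing R
  letI : Algebra (MvPolynomial (Fin n) R) (MvPolynomial (Fin n) K) := MvPolynomial.algebraMvPolynomial
  have h1 := macaulay (fun i => map (algebraMap R K) (f i)) d hd (fun i => (hf i).map _)
    (fun i h => hf0 i (map_injective _ (IsFractionRing.injective R K) (by simpa using h)))
    (map_integral K f hInt) e he (map (algebraMap R K) x) (hx.map _)
  have h2 : Ideal.span (Set.range fun i => map (algebraMap R K) (f i)) =
      (Ideal.span (Set.range f)).map (algebraMap (MvPolynomial (Fin n) R) (MvPolynomial (Fin n) K)) := by
    rw [Ideal.map_span, ← Set.range_comp]; rfl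
  have h3 : map (algebraMap R K) x = algebraMap (MvPolynomial (Fin n) R) (MvPolynomial (Fin n) K) x := rfl
  rw [h2, h3, IsLocalization.algebraMap_mem_map_algebraMap_iff ((nonZeroDivisors R).map (C : R →+* MvPolynomial (Fin n) R))] at h1
  obtain ⟨m, hm, hmx⟩ := h1
  obtain ⟨r, hr, rfl⟩ := hm
  exact ⟨r, hr, by rw [smul_eq_C_mul]; exact hmx⟩

theorem torsion_gen {R : Type*} [CommRing R] [IsDomain R] {n : ℕ}
    (f : Fin n → MvPolynomial (Fin n) R) (d : Fin n → ℕ) (hd : ∀ i, 0 < d i)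
    (hf : ∀ i, (f i).IsHomogeneous (d i)) (hf0 : ∀ i, f i ≠ 0)
    (hInt : (aeval f : MvPolynomial (Fin n) R →ₐ[R] MvPolynomial (Fin n) R).toRingHom.IsIntegral)
    (x : MvPolynomial (Fin n) R) :
    ∃ r ∈ nonZeroDivisors R, r • x ∈ Submodule.span (Algebra.adjoin R (Set.range f))
      {z | ∃ e ≤ ∑ i, (d i - 1), z.IsHomogeneous e} := by
  refine good_of_hom _ _ x fun e => ?_
  refine ascend ⊤ (fun _ _ _ => trivial) f d hd hf (nonZeroDivisors R) _ (by rintro z ⟨e, _, h⟩; exact ⟨e, h⟩) e ?_ e le_rfl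
    _ trivial (homogeneousComponent_isHomogeneous _ _)
  intro e' _ b _ hb
  by_cases he : e' ≤ ∑ i, (d i - 1)
  · exact ⟨1, Submonoid.one_mem _, b, Submodule.subset_span ⟨e', he, hb⟩, 0, by simp, by simp⟩
  · obtain ⟨r, hr, hrb⟩ := torsion_mem f d hd hf hf0 hInt e' (by omega) b hb
    obtain ⟨g, hg⟩ := Ideal.mem_span_range_iff_exists_fun.1 hrb
    exact ⟨r, hr, 0, zero_mem _, g, fun _ => trivial, by rw [hg, zero_add]⟩
end CMBound

namespace CMBound
open Module RingTheory.Sequence IsLocalRing MvPolynomial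

section
variable {R : Type*} [CommRing R] {n : ℕ}

theorem mem_inv {G : Subgroup (Matrix.GeneralLinearGroup (Fin n) R)} {b : MvPolynomial (Fin n) R} :
    b ∈ invariants G ↔ ∀ σ ∈ G, glAct σ b = b := by
  simp [invariants, Algebra.mem_iInf]

theorem glAct_X (σ : Matrix.GeneralLinearGroup (Fin n) R) (i : Fin n) :
    glAct σ (X i) = ∑ j, ((σ⁻¹ : Matrix.GeneralLinearGroup (Fin n) R) : Matrix (Fin n) (Fin n) R) i j •
      (X j : MvPolynomial (Fin n) R) := by
  simp [glAct]

theorem glAct_one : glAct (1 : Matrix.GeneralLinearGroup (Fin n) R) = AlgHom.id R _ := by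
  refine MvPolynomial.algHom_ext fun i => ?_
  rw [glAct_X]
  simp [Matrix.one_apply, ite_smul]

theorem glAct_mul (σ τ : Matrix.GeneralLinearGroup (Fin n) R) :
    glAct (σ * τ) = (glAct σ).comp (glAct τ) := by
  refine MvPolynomial.algHom_ext fun i => ?_
  rw [AlgHom.comp_apply, glAct_X, glAct_X, map_sum]
  simp_rw [map_smul, glAct_X, mul_inv_rev, Units.val_mul, Matrix.mul_apply, Finset.sum_smul,
    Finset.smul_sum, smul_smul]
  exact Finset.sum_comm

theorem glAct_inj (σ τ : Matrix.GeneralLinearGroup (Fin n) R) (h : glAct σ = glAct τ) : σ = τ := by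
  apply inv_injective
  ext i j
  have h1 := congrArg (fun φ => coeff (Finsupp.single j 1) (φ (X i))) h
  simp only [glAct_X, coeff_sum, coeff_smul, coeff_X, smul_eq_mul] at h1
  simpa [coeff_X', Finsupp.single_left_inj] using h1

theorem glAct_hom (σ : Matrix.GeneralLinearGroup (Fin n) R) {p : MvPolynomial (Fin n) R} {e : ℕ}
    (hp : p.IsHomogeneous e) : (glAct σ p).IsHomogeneous e := by
  have := hp.aeval (fun i => ∑ j, ((σ⁻¹ : Matrix.GeneralLinearGroup (Fin n) R) : Matrix (Fin n) (Fin n) R) i j •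
      (X j : MvPolynomial (Fin n) R)) (n := 1) (fun i => by
    refine IsHomogeneous.sum _ _ _ fun j _ => ?_
    rw [smul_eq_C_mul]
    simpa using (isHomogeneous_C (Fin n) _).mul (isHomogeneous_X R j))
  rwa [one_mul] at this

theorem glAct_hc (σ : Matrix.GeneralLinearGroup (Fin n) R) (p : MvPolynomial (Fin n) R) (k : ℕ) :
    homogeneousComponent k (glAct σ p) = glAct σ (homogeneousComponent k p) := by
  have h1 : homogeneousComponent k (glAct σ (∑ i ∈ Finset.range (p.totalDegree + 1), homogeneousComponent i p)) = glAct σ (homogeneousComponent k (∑ i ∈ Finset.range (p.totalDegree + 1), homogeneousComponent i p)) := by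
    simp_rw [map_sum]
    refine Finset.sum_congr rfl fun i _ => ?_
    have h := homogeneousComponent_isHomogeneous i p
    rw [homogeneousComponent_of_mem ((mem_homogeneousSubmodule _ _).2 h),
      homogeneousComponent_of_mem ((mem_homogeneousSubmodule _ _).2 (glAct_hom σ h))]
    split_ifs <;> simp
  rwa [sum_homogeneousComponent] at h1

theorem inv_hc (G : Subgroup (Matrix.GeneralLinearGroup (Fin n) R)) :
    ∀ b ∈ invariants G, ∀ k, homogeneousComponent k b ∈ invariants G := by
  intro b hb k
  rw [mem_inv] at hb ⊢
  intro σ hσ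
  rw [← glAct_hc, hb σ hσ]

/-- The action as a semiring action. -/
noncomputable def act (G : Subgroup (Matrix.GeneralLinearGroup (Fin n) R)) :
    MulSemiringAction G (MvPolynomial (Fin n) R) where
  smul σ p := glAct σ.1 p
  one_smul p := by change glAct 1 p = p; rw [glAct_one]; rfl
  mul_smul σ τ p := by change glAct (σ.1 * τ.1) p = _; rw [glAct_mul]; rfl
  smul_zero σ := map_zero (glAct σ.1)
  smul_add σ := map_add (glAct σ.1)
  smul_one σ := map_one (glAct σ.1)
  smul_mul σ := map_mul (glAct σ.1)

theorem inv_integral (G : Subgroup (Matrix.GeneralLinearGroup (Fin n) R)) [Finite G] :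
    Algebra.IsIntegral (invariants G) (MvPolynomial (Fin n) R) := by
  letI := act G
  haveI : Algebra.IsInvariant (invariants G) (MvPolynomial (Fin n) R) G :=
    ⟨fun b hb => ⟨⟨b, mem_inv.2 fun σ hσ => hb ⟨σ, hσ⟩⟩, rfl⟩⟩
  haveI : SMulCommClass G (invariants G) (MvPolynomial (Fin n) R) := ⟨fun σ b p => by
    change glAct σ.1 (b.1 * p) = b.1 * glAct σ.1 p
    rw [map_mul, mem_inv.1 b.2 σ.1 σ.2]⟩
  exact Algebra.IsInvariant.isIntegral _ _ G

/-- The transfer. -/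
noncomputable def tr (G : Subgroup (Matrix.GeneralLinearGroup (Fin n) R)) [Fintype G] :
    MvPolynomial (Fin n) R →ₗ[R] MvPolynomial (Fin n) R :=
  ∑ σ : G, (glAct σ.1).toLinearMap

theorem tr_apply (G : Subgroup (Matrix.GeneralLinearGroup (Fin n) R)) [Fintype G] (p) :
    tr G p = ∑ σ : G, glAct σ.1 p := by
  simp [tr]

theorem tr_mem (G : Subgroup (Matrix.GeneralLinearGroup (Fin n) R)) [Fintype G] (p) :
    tr G p ∈ invariants G := by
  rw [mem_inv]
  intro τ hτ
  rw [tr_apply, map_sum]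
  refine Fintype.sum_equiv (Equiv.mulLeft (⟨τ, hτ⟩ : G)) _ _ fun σ => ?_
  change _ = glAct (τ * σ.1) p
  rw [glAct_mul]; rfl

theorem tr_mul (G : Subgroup (Matrix.GeneralLinearGroup (Fin n) R)) [Fintype G] (b p)
    (hb : b ∈ invariants G) : tr G (b * p) = b * tr G p := by
  rw [tr_apply, tr_apply, Finset.mul_sum]
  refine Finset.sum_congr rfl fun σ _ => ?_
  rw [map_mul, mem_inv.1 hb σ.1 σ.2]

theorem tr_hom (G : Subgroup (Matrix.GeneralLinearGroup (Fin n) R)) [Fintype G] {p} {e : ℕ}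
    (hp : p.IsHomogeneous e) : (tr G p).IsHomogeneous e := by
  rw [tr_apply]
  exact IsHomogeneous.sum _ _ _ fun σ _ => glAct_hom _ hp

theorem tr_ne [IsDomain R] (G : Subgroup (Matrix.GeneralLinearGroup (Fin n) R)) [Fintype G] :
    ∃ p, tr G p ≠ 0 := by
  by_contra! h
  have h1 := linearIndependent_monoidHom (MvPolynomial (Fin n) R) (MvPolynomial (Fin n) R)
  have h2 := h1.comp (fun σ : G => ((glAct σ.1).toRingHom : MvPolynomial (Fin n) R →* MvPolynomial (Fin n) R))
    (fun σ τ hst => Subtype.ext (glAct_inj _ _ (AlgHom.ext fun p => DFunLike.congr_fun hst p)))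
  rw [Fintype.linearIndependent_iff] at h2
  have := h2 (fun _ => 1) (by
    refine funext fun p => ?_
    have := h p
    rw [tr_apply] at this
    simpa using this) 1
  exact one_ne_zero this
end
end CMBound

namespace CMBound
open Module RingTheory.Sequence IsLocalRing MvPolynomial

section
variable {R : Type*} [CommRing R] {n : ℕ}

/-- B as a subalgebra over A. -/
def overA (A B : Subalgebra R (MvPolynomial (Fin n) R)) (hAB : A ≤ B) :
    Subalgebra A (MvPolynomial (Fin n) R) where
  carrier := B
  mul_mem' := B.mul_mem
  add_mem' := B.add_mem
  algebraMap_mem' := fun a => hAB a.2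

theorem overA_eq (A B : Subalgebra R (MvPolynomial (Fin n) R)) (hAB : A ≤ B)
    (s : Set (MvPolynomial (Fin n) R)) (hs : s ⊆ (B : Set _))
    (h : (B : Set (MvPolynomial (Fin n) R)) ⊆ (Submodule.span A s : Submodule A (MvPolynomial (Fin n) R))) :
    Subalgebra.toSubmodule (overA A B hAB) = Submodule.span A s :=
  le_antisymm (fun _ hx => h hx) (Submodule.span_le.2 fun _ hx => hs hx)

theorem overA_fg (A B : Subalgebra R (MvPolynomial (Fin n) R)) (hAB : A ≤ B)
    (s : Finset (MvPolynomial (Fin n) R)) (hs : (s : Set (MvPolynomial (Fin n) R)) ⊆ (B : Set (MvPolynomial (Fin n) R)))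
    (h : (B : Set (MvPolynomial (Fin n) R)) ⊆
      (Submodule.span A (s : Set (MvPolynomial (Fin n) R)) : Submodule A (MvPolynomial (Fin n) R))) :
    (Subalgebra.toSubmodule (overA A B hAB)).FG :=
  ⟨s, (overA_eq A B hAB s hs h).symm⟩

theorem adjoin_le_of (B : Subalgebra R (MvPolynomial (Fin n) R)) (f : Fin n → B) :
    Algebra.adjoin R (Set.range fun i => (f i : MvPolynomial (Fin n) R)) ≤ B :=
  Algebra.adjoin_le (by rintro _ ⟨i, rfl⟩; exact (f i).2)

theorem coe_aeval_B (B : Subalgebra R (MvPolynomial (Fin n) R)) (f : Fin n → B)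
    (p : MvPolynomial (Fin n) R) : ((aeval f p : B) : MvPolynomial (Fin n) R) =
      aeval (fun i => (f i : MvPolynomial (Fin n) R)) p := by
  have : B.val.comp (aeval f : MvPolynomial (Fin n) R →ₐ[R] B) =
      aeval (fun i => (f i : MvPolynomial (Fin n) R)) := by
    refine MvPolynomial.algHom_ext fun i => ?_
    simp
  exact DFunLike.congr_fun this p

theorem fin_integral (B : Subalgebra R (MvPolynomial (Fin n) R)) (f : Fin n → B)
    (hind : AlgebraicIndependent R (fun i => (f i : MvPolynomial (Fin n) R)))
    (hfg : (Subalgebra.toSubmodule (overA _ B (adjoin_le_of B f))).FG) :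
    (aeval f : MvPolynomial (Fin n) R →ₐ[R] B).toRingHom.IsIntegral := by
  intro b
  obtain ⟨q, hq, hq'⟩ := IsIntegral.of_mem_of_fg _ hfg b.1 b.2
  let e := hind.aevalEquiv
  refine ⟨q.map e.symm.toAlgHom.toRingHom, hq.map _, ?_⟩
  apply Subtype.val_injective
  change B.val.toRingHom _ = _
  rw [Polynomial.hom_eval₂, Polynomial.eval₂_map]
  refine Eq.trans ?_ hq'
  refine congrArg (fun φ => Polynomial.eval₂ φ b.1 q) (RingHom.ext fun a => ?_)
  change ((aeval f (e.symm a) : B) : MvPolynomial (Fin n) R) = a.1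
  rw [coe_aeval_B, ← hind.algebraMap_aevalEquiv]
  change ((e (e.symm a)).1) = a.1
  rw [AlgEquiv.apply_symm_apply]

theorem fin_noeth [IsNoetherianRing R] (B : Subalgebra R (MvPolynomial (Fin n) R)) (f : Fin n → B)
    (hind : AlgebraicIndependent R (fun i => (f i : MvPolynomial (Fin n) R)))
    (hfg : (Subalgebra.toSubmodule (overA _ B (adjoin_le_of B f))).FG) :
    IsNoetherianRing B := by
  let A := Algebra.adjoin R (Set.range fun i => (f i : MvPolynomial (Fin n) R))
  haveI : IsNoetherianRing A := isNoetherianRing_of_ringEquiv _ hind.aevalEquiv.toRingEquiv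
  haveI : Module.Finite A (overA A B (adjoin_le_of B f)) := Module.Finite.iff_fg.2 hfg
  have h : IsNoetherianRing (overA A B (adjoin_le_of B f)) := IsNoetherianRing.of_finite A (overA A B (adjoin_le_of B f))
  let e : (overA A B (adjoin_le_of B f)) ≃+* B :=
    { toFun := fun x => ⟨x.1, x.2⟩
      invFun := fun x => ⟨x.1, x.2⟩
      left_inv := fun _ => rfl
      right_inv := fun _ => rfl
      map_mul' := fun _ _ => rfl
      map_add' := fun _ _ => rfl }
  exact isNoetherianRing_of_ringEquiv _ e

theorem S_integral (B : Subalgebra R (MvPolynomial (Fin n) R))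
    [Algebra.IsIntegral B (MvPolynomial (Fin n) R)] (f : Fin n → B)
    (hInt : (aeval f : MvPolynomial (Fin n) R →ₐ[R] B).toRingHom.IsIntegral) :
    (aeval (fun i => (f i : MvPolynomial (Fin n) R)) :
      MvPolynomial (Fin n) R →ₐ[R] MvPolynomial (Fin n) R).toRingHom.IsIntegral := by
  have h2 : (algebraMap B (MvPolynomial (Fin n) R)).IsIntegral := fun x =>
    Algebra.IsIntegral.isIntegral x
  have := RingHom.IsIntegral.trans _ _ hInt h2
  have h3 : (aeval (fun i => (f i : MvPolynomial (Fin n) R)) :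
      MvPolynomial (Fin n) R →ₐ[R] MvPolynomial (Fin n) R).toRingHom =
      (algebraMap B (MvPolynomial (Fin n) R)).comp
        (aeval f : MvPolynomial (Fin n) R →ₐ[R] B).toRingHom :=
    RingHom.ext fun p => (coe_aeval_B B f p).symm
  rw [h3]
  exact this

theorem exists_mul_eq [IsDomain R] (B : Subalgebra R (MvPolynomial (Fin n) R)) (f : Fin n → B)
    (hInt : (aeval f : MvPolynomial (Fin n) R →ₐ[R] B).toRingHom.IsIntegral) (t : B) (ht : t ≠ 0) :
    ∃ p : MvPolynomial (Fin n) R, p ≠ 0 ∧ ∃ t', aeval f p = t * t' := by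
  letI := (aeval f : MvPolynomial (Fin n) R →ₐ[R] B).toRingHom.toAlgebra
  have h : IsIntegral (MvPolynomial (Fin n) R) t := hInt t
  obtain ⟨p, hp, t', h'⟩ := h.isAlgebraic.exists_nonzero_dvd (mem_nonZeroDivisors_of_ne_zero ht)
  exact ⟨p, hp, t', h'⟩
end
end CMBound

namespace CMBound
open Module RingTheory.Sequence IsLocalRing MvPolynomial

section
variable {R : Type*} [CommRing R] {n : ℕ}

theorem mem_ofList_ofFn {C : Type*} [CommRing C] {k : ℕ} (f : Fin k → C) (x : C) :
    x ∈ Ideal.ofList (List.ofFn f) ↔ ∃ g : Fin k → C, ∑ i, g i * f i = x := by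
  have h : Ideal.ofList (List.ofFn f) = Ideal.span (Set.range f) := by
    unfold Ideal.ofList; congr 1; ext; simp [List.mem_ofFn]
  rw [h, Ideal.mem_span_range_iff_exists_fun]

theorem span_good [IsDomain R] {A : Subalgebra R (MvPolynomial (Fin n) R)}
    (T : Submodule A (MvPolynomial (Fin n) R)) (V : Set (MvPolynomial (Fin n) R))
    (h : ∀ v ∈ V, ∃ r ∈ nonZeroDivisors R, r • v ∈ T) (x : MvPolynomial (Fin n) R)
    (hx : x ∈ Submodule.span A V) : ∃ r ∈ nonZeroDivisors R, r • x ∈ T := by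
  induction hx using Submodule.span_induction with
  | mem x hx => exact h x hx
  | zero => exact ⟨1, Submonoid.one_mem _, by simp⟩
  | add x y _ _ hx hy =>
    obtain ⟨r, hr, hx⟩ := hx
    obtain ⟨r', hr', hy⟩ := hy
    refine ⟨r * r', Submonoid.mul_mem _ hr hr', ?_⟩
    rw [smul_add]
    refine add_mem ?_ ?_
    · rw [mul_comm, mul_smul]; exact smulR_mem _ _ hx
    · rw [mul_smul]; exact smulR_mem _ _ hy
  | smul a x _ hx =>
    obtain ⟨r, hr, hx⟩ := hx
    refine ⟨r, hr, ?_⟩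
    rw [smul_comm]
    exact T.smul_mem _ hx

/-- Maximal independent homogeneous family generating up to torsion. -/
theorem max_family [IsDomain R] (B : Subalgebra R (MvPolynomial (Fin n) R))
    (hB : ∀ b ∈ B, ∀ k, homogeneousComponent k b ∈ B)
    (f : Fin n → B) (d : Fin n → ℕ) (hd : ∀ i, 0 < d i)
    (hf : ∀ i, (f i : MvPolynomial (Fin n) R).IsHomogeneous (d i)) (N : ℕ) :
    ∃ W : Set B, (∀ w ∈ W, ∃ e ≤ N, (w : MvPolynomial (Fin n) R).IsHomogeneous e) ∧
      (∀ (t : Finset B), (t : Set B) ⊆ W → ∀ c : B → R,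
        ∑ w ∈ t, c w • w ∈ Ideal.ofList (List.ofFn f) → ∀ w ∈ t, c w = 0) ∧
      ∀ e ≤ N, ∀ b ∈ B, b.IsHomogeneous e → ∃ r ∈ nonZeroDivisors R,
        r • b ∈ Submodule.span (Algebra.adjoin R (Set.range fun i => (f i : MvPolynomial (Fin n) R)))
          (Subtype.val '' W) := by
  classical
  let V : Set B := {z | ∃ e ≤ N, (z : MvPolynomial (Fin n) R).IsHomogeneous e}
  let I := Ideal.ofList (List.ofFn f)
  let π : B →ₗ[R] (B ⧸ I) := (Ideal.Quotient.mkₐ R I).toLinearMap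
  have hπ : ∀ x, π x = 0 ↔ x ∈ I := fun x => Ideal.Quotient.eq_zero_iff_mem
  obtain ⟨s, hs, hs'⟩ := exists_maximal_linearIndepOn R (fun v : V => π v.1)
  refine ⟨Subtype.val '' s, ?_, ?_, ?_⟩
  · rintro _ ⟨w, _, rfl⟩
    exact w.2
  · intro t ht c hc
    rw [linearIndepOn_iff'] at hs
    have htV : ∀ x ∈ t, x ∈ V := fun x hx => by
      obtain ⟨w, _, rfl⟩ := ht hx
      exact w.2
    have h1 := hs (t.subtype (· ∈ V)) (fun v => c v.1) (by
      intro x hx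
      have hx' : x.1 ∈ t := by simpa using hx
      obtain ⟨w, hw, hwx⟩ := ht hx'
      rwa [← Subtype.ext hwx]) (by
      rw [Finset.sum_subtype_of_mem (fun v => c v • π v) htV]
      rw [← hπ, map_sum] at hc
      simpa using hc)
    intro w hw
    exact h1 ⟨w, htV w hw⟩ (by simpa using hw)
  · refine ascend B hB _ d hd hf (nonZeroDivisors R) _ ?_ N ?_
    · rintro _ ⟨_, ⟨w, _, rfl⟩, rfl⟩
      obtain ⟨e, _, h⟩ := w.2
      exact ⟨e, h⟩
    · intro e he b hb hbe
      let v : V := ⟨⟨b, hb⟩, e, he, hbe⟩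
      by_cases hv : v ∈ s
      · exact ⟨1, Submonoid.one_mem _, b, Submodule.subset_span ⟨v.1, ⟨v, hv, rfl⟩, rfl⟩, 0,
          fun i => B.zero_mem, by simp⟩
      · obtain ⟨a, ha, hav⟩ := hs' v hv
        have h1 : (fun v : V => π v.1) '' s = π '' (Subtype.val '' s) := by
          rw [Set.image_image]
        rw [h1, Submodule.span_image] at hav
        obtain ⟨t, ht, hta⟩ := hav
        have h2 : a • v.1 - t ∈ I := by
          rw [← hπ, map_sub, map_smul, hta, sub_self]
        obtain ⟨g, hg⟩ := (mem_ofList_ofFn f _).1 h2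
        refine ⟨a, mem_nonZeroDivisors_of_ne_zero ha, t.1, ?_, fun i => (g i).1, fun i => (g i).2, ?_⟩
        · have h3 := Submodule.mem_map_of_mem (f := B.val.toLinearMap) ht
          rw [← Submodule.span_image] at h3
          exact h3
        · have h4 := congrArg (Subtype.val) hg
          rw [AddSubmonoidClass.coe_finset_sum] at h4
          change _ = a • b - t.1 at h4
          rw [eq_sub_iff_add_eq, add_comm] at h4
          rw [← h4]; rfl

theorem key [IsDomain R] [IsNoetherianRing R] (B : Subalgebra R (MvPolynomial (Fin n) R))
    [IsNoetherianRing B] [Algebra.IsIntegral B (MvPolynomial (Fin n) R)]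
    (hB : ∀ b ∈ B, ∀ k, homogeneousComponent k b ∈ B)
    (f : Fin n → B) (d : Fin n → ℕ) (hd : ∀ i, 0 < d i)
    (hf : ∀ i, (f i : MvPolynomial (Fin n) R).IsHomogeneous (d i))
    (hind : AlgebraicIndependent R (fun i => (f i : MvPolynomial (Fin n) R)))
    (hInt : (aeval f : MvPolynomial (Fin n) R →ₐ[R] B).toRingHom.IsIntegral)
    (hreg : IsWeaklyRegular B (List.ofFn f))
    (htf : ∀ a : R, a ≠ 0 → ∀ b : B, a • b ∈ Ideal.ofList (List.ofFn f) →
      b ∈ Ideal.ofList (List.ofFn f))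
    (tr : MvPolynomial (Fin n) R →ₗ[R] MvPolynomial (Fin n) R)
    (tr_mem : ∀ p, tr p ∈ B) (tr_mul : ∀ b p, b ∈ B → tr (b * p) = b * tr p)
    (tr_hom : ∀ p e, p.IsHomogeneous e → (tr p).IsHomogeneous e) (tr_ne : ∃ p, tr p ≠ 0)
    (e : ℕ) (he : ∑ i, (d i - 1) < e) (b : B)
    (hb : (b : MvPolynomial (Fin n) R).IsHomogeneous e) : b ∈ Ideal.ofList (List.ofFn f) := by
  classical
  by_contra hbI
  obtain ⟨W, hW1, hW2, hW3⟩ := max_family B hB f d hd hf (∑ i, (d i - 1))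
  set A := Algebra.adjoin R (Set.range fun i => (f i : MvPolynomial (Fin n) R)) with hA
  have hAB : A ≤ B := adjoin_le_of B f
  obtain ⟨s0, hs0⟩ := tr_ne
  obtain ⟨p, hp, t', ht'⟩ := exists_mul_eq B f hInt ⟨tr s0, tr_mem s0⟩
    (fun h => hs0 (congrArg Subtype.val h))
  obtain ⟨r, hr, hr'⟩ := torsion_gen (fun i => (f i : MvPolynomial (Fin n) R)) d hd hf
    (fun i => hind.ne_zero i) (S_integral B f hInt) ((t' * b : B) * s0)
  have h1 : r • (((aeval f p * b : B)) : MvPolynomial (Fin n) R) ∈ Submodule.span A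
      {z | z ∈ B ∧ ∃ e ≤ ∑ i, (d i - 1), z.IsHomogeneous e} := by
    let trA : MvPolynomial (Fin n) R →ₗ[A] MvPolynomial (Fin n) R :=
      { toFun := tr
        map_add' := map_add tr
        map_smul' := fun a x => tr_mul a.1 x (hAB a.2) }
    have h2 := Submodule.mem_map_of_mem (f := trA) hr'
    rw [← Submodule.span_image] at h2
    have h3 : trA (r • ((t' * b : B) * s0)) = r • (((aeval f p * b : B)) : MvPolynomial (Fin n) R) := by
      change tr _ = _
      rw [map_smul, tr_mul _ _ (t' * b).2, ht']
      congr 1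
      push_cast
      ring
    rw [h3] at h2
    refine Submodule.span_mono ?_ h2
    rintro _ ⟨z, ⟨e, he, hz⟩, rfl⟩
    exact ⟨tr_mem z, e, he, tr_hom z e hz⟩
  obtain ⟨r', hr'', h2⟩ := span_good (Submodule.span A (Subtype.val '' W))
    {z | z ∈ B ∧ ∃ e ≤ ∑ i, (d i - 1), z.IsHomogeneous e}
    (by rintro v ⟨hv, e, he, hve⟩; exact hW3 e he v hv hve) _ h1
  rw [Submodule.mem_span_image_iff_exists_fun] at h2
  obtain ⟨t, htW, c, hc⟩ := h2
  have hcq : ∀ i, ∃ q : MvPolynomial (Fin n) R, aeval f q = (⟨(c i).1, hAB (c i).2⟩ : B) := by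
    intro i
    refine ⟨hind.aevalEquiv.symm (c i), Subtype.ext ?_⟩
    rw [coe_aeval_B, ← hind.algebraMap_aevalEquiv, AlgEquiv.apply_symm_apply]
    rfl
  choose q hq using hcq
  let fam : Option B → B := fun o => o.elim b id
  let P : Option B → MvPolynomial (Fin n) R := fun o => o.elim (- C (r' * r) * p)
    (fun w => if h : w ∈ t then q ⟨w, h⟩ else 0)
  have hb_not : ∀ c : Option B → R, ∑ j ∈ Finset.insertNone t, c j • fam j ∈ Ideal.ofList (List.ofFn f) →
      ∀ j ∈ Finset.insertNone t, c j = 0 := by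
    intro c hc
    rw [Finset.sum_insertNone] at hc
    have h0 : c none = 0 := by
      by_contra h0
      apply hbI
      apply htf _ h0
      have h3 := ofList_hc B hB f d hf _ (fun _ h => h) _ hc e
      rw [map_add, map_sum, map_smul, show fam none = b from rfl, hcB_self B hB _ e hb, Finset.sum_eq_zero, add_zero] at h3
      · exact h3
      · intro w hw
        obtain ⟨e', he', hwe⟩ := hW1 w (htW hw)
        rw [map_smul]
        have : hcB B hB e (fam (some w)) = 0 := by
          apply Subtype.ext
          rw [hcB_coe]
          change homogeneousComponent e (w : MvPolynomial (Fin n) R) = 0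
          rw [homogeneousComponent_of_mem ((mem_homogeneousSubmodule _ _).2 hwe), if_neg (by omega)]
        rw [this, smul_zero]
    rw [h0, zero_smul, zero_add] at hc
    have h4 := hW2 t htW (fun w => c (some w)) hc
    intro j hj
    cases j with
    | none => exact h0
    | some w => exact h4 w (by simpa using hj)
  have hfin := indep (Finset.insertNone t) n f fam hreg hb_not P (by
    rw [Finset.sum_insertNone]
    apply Subtype.ext
    have h5 : ∑ w ∈ t, (aeval f (P (some w)) * fam (some w) : B) =
        ∑ i : t, (⟨(c i).1, hAB (c i).2⟩ : B) * i.1 := by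
      rw [← Finset.sum_coe_sort t]
      refine Finset.sum_congr rfl fun i _ => ?_
      simp only [P, fam, Option.elim, i.2, dif_pos, id]
      rw [hq]
    rw [h5]
    have h6 : ((∑ i : t, (⟨(c i).1, hAB (c i).2⟩ : B) * i.1 : B) : MvPolynomial (Fin n) R) =
      r' • r • (((aeval f p * b : B)) : MvPolynomial (Fin n) R) := by
      rw [← hc, AddSubmonoidClass.coe_finset_sum]
      rfl
    rw [Subalgebra.coe_add, h6]
    simp only [P, fam, Option.elim]
    rw [map_mul, map_neg, smul_smul, smul_eq_C_mul, algHom_C]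
    push_cast
    simp only [algebraMap_eq, C_mul]
    ring) none (by simp)
  have : C (r' * r) * p = 0 := by
    simpa [P] using hfin
  rcases mul_eq_zero.1 this with h | h
  · rw [C_eq_zero] at h
    exact (nonZeroDivisors.ne_zero (Submonoid.mul_mem _ hr'' hr)) h
  · exact hp h
end
end CMBound

/-- Let `R` be a Noetherian integral domain, `G ⊆ GLₙ(R)` a finite
subgroup with `S^G = R[x₁,…,xₙ]^G` Cohen-Macaulay, and let `f₁,…,fₙ` be a homogeneous
system of parameters in `S^G` with `deg fᵢ = dᵢ`. Then `S^G` is generated as a module over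
`R[f₁,…,fₙ]` by homogeneous invariants of degree at most `∑ᵢ (dᵢ - 1)`. -/
theorem stmt_14 {n : ℕ} (R : Type*) [CommRing R] [IsDomain R] [IsNoetherianRing R]
    (G : Subgroup (Matrix.GeneralLinearGroup (Fin n) R)) [Finite G]
    (f : Fin n → MvPolynomial (Fin n) R) (d : Fin n → ℕ)
    (hd : ∀ i, (f i).IsHomogeneous (d i)) (hsop : IsHSOPInv G f)
    (hCM : IsCohenMacaulayRing ↥(invariants G)) :
    ∃ s : Finset (MvPolynomial (Fin n) R),
      ↑s ⊆ (invariants G : Set (MvPolynomial (Fin n) R)) ∧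
      (∀ g ∈ s, ∃ e ≤ ∑ i, (d i - 1), MvPolynomial.IsHomogeneous g e) ∧
      (invariants G : Set (MvPolynomial (Fin n) R)) ⊆
        (Submodule.span (Algebra.adjoin R (Set.range f)) (s : Set (MvPolynomial (Fin n) R)) :
          Submodule (Algebra.adjoin R (Set.range f)) (MvPolynomial (Fin n) R)) := by
  classical
  haveI : Fintype G := Fintype.ofFinite G
  obtain ⟨hfB, hpos, hind, s, hsB, hspan⟩ := hsop
  have hf0 : ∀ i, f i ≠ 0 := fun i => hind.ne_zero i
  have hdpos : ∀ i, 0 < d i := by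
    intro i
    obtain ⟨d', hd', h⟩ := hpos i
    rwa [(hd i).inj_right h (hf0 i)]
  let fB : Fin n → invariants G := fun i => ⟨f i, hfB i⟩
  have hB := CMBound.inv_hc G
  have hfg := CMBound.overA_fg (Algebra.adjoin R (Set.range f)) (invariants G)
    (CMBound.adjoin_le_of (invariants G) fB) s hsB hspan
  haveI := CMBound.inv_integral G
  haveI : IsNoetherianRing (invariants G) := CMBound.fin_noeth (invariants G) fB hind hfg
  have hInt := CMBound.fin_integral (invariants G) fB hind hfg
  have hCM' := fun (m : Ideal R) [m.IsMaximal] =>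
    hCM (CMBound.originIdeal (invariants G) m) inferInstance
  have hreg := CMBound.global_reg (invariants G) hB fB d hdpos hd hInt hCM'
  have htf := CMBound.global_tf (invariants G) hB fB d hdpos hd hInt hCM'
  have hkey := CMBound.key (invariants G) hB fB d hdpos hd hind hInt hreg htf (CMBound.tr G)
    (CMBound.tr_mem G) (fun b p hb => CMBound.tr_mul G b p hb)
    (fun p e hp => CMBound.tr_hom G hp) (CMBound.tr_ne G)
  let W : Set (MvPolynomial (Fin n) R) :=
    {z | z ∈ invariants G ∧ ∃ e ≤ ∑ i, (d i - 1), z.IsHomogeneous e}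
  have hgen : (invariants G : Set (MvPolynomial (Fin n) R)) ⊆
      (Submodule.span (Algebra.adjoin R (Set.range f)) W :
        Submodule (Algebra.adjoin R (Set.range f)) (MvPolynomial (Fin n) R)) := by
    intro b hb
    have h1 := CMBound.good_of_hom ⊥ (Submodule.span (Algebra.adjoin R (Set.range f)) W) b (by
      intro e
      refine CMBound.ascend (invariants G) hB f d hdpos hd ⊥ W
        (by rintro z ⟨_, e, _, h⟩; exact ⟨e, h⟩) e ?_ e le_rfl _ (hB b hb e)
        (homogeneousComponent_isHomogeneous _ _)
      intro e' _ b' hb' hbe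
      by_cases he : e' ≤ ∑ i, (d i - 1)
      · exact ⟨1, Submonoid.one_mem _, b', Submodule.subset_span ⟨hb', e', he, hbe⟩, 0,
          fun i => (invariants G).zero_mem, by simp⟩
      · have h2 := hkey e' (by omega) ⟨b', hb'⟩ hbe
        obtain ⟨g, hg⟩ := (CMBound.mem_ofList_ofFn fB _).1 h2
        refine ⟨1, Submonoid.one_mem _, 0, zero_mem _, fun i => (g i).1, fun i => (g i).2, ?_⟩
        have h4 := congrArg (Subtype.val) hg
        rw [AddSubmonoidClass.coe_finset_sum] at h4
        rw [one_smul, zero_add]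
        exact h4.symm)
    obtain ⟨r, hr, hrb⟩ := h1
    rw [Submonoid.mem_bot] at hr
    rwa [hr, one_smul] at hrb
  have hWB : W ⊆ (invariants G : Set (MvPolynomial (Fin n) R)) := fun z hz => hz.1
  have heq := CMBound.overA_eq (Algebra.adjoin R (Set.range f)) (invariants G)
    (CMBound.adjoin_le_of (invariants G) fB) W hWB hgen
  rw [heq, Submodule.fg_span_iff_fg_span_finset_subset] at hfg
  obtain ⟨s', hs', hs''⟩ := hfg
  refine ⟨s', hs'.trans hWB, fun g hg => (hs' hg).2, ?_⟩
  rw [← hs'']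
  exact hgen
end
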